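/- arXiv:1407.3263 — 4 statements merged into one kernel-verified Lean document; each statement's English description precedes it below -/
import Mathlib

section
/- Let g* be a valid partial assignment, x* ∈ [0,1]^{F×D}, y* ∈ [0,1]^F, and suppose MFN(g*,x*,y*) is infeasible. Write c_a(g*,x,y) for the capacity of arc a in MFN(g*,x,y) (a linear function of (x,y) for fixed g*) and d_j := 1 − Σ_{i∈F} g*_{ij}. Then there exist z ∈ [0,1]^D and ℓ ∈ [0,1]^{A} (A being the arc set of the network) such that: (1) z_j ≤ Σ_{a∈P} ℓ_a for every j ∈ D and every directed path P from j^s to j^t; (2) Σ_{j∈D} d_j·z_j > Σ_{a∈A} c_a(g*,x*,y*)·ℓ_a; and (3) Σ_{j∈D} d_j·z_j ≤ Σ_{a∈A} c_a(g*,x,y)·ℓ_a for every pair (x,y) ∈ [0,1]^{F×D} × [0,1]^F for which MFN(g*,x,y) is feasible. In other words, the inequality in (3) is valid for MFNLP but violated by (x*,y*). -/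
/-!
Formalization of statements from "An LP-rounding approach to capacitated facility location".

`F` is the (finite) type of facilities, `D` the type of clients, `U i` the (positive integer)
capacity of facility `i`.  The multi-commodity flow network `MFN(g, x, y)` has nodes
`j^s, j^t` for clients `j` and `i, i'` for facilities `i`; its arcs and capacities are as in
`MFNArc` / `mfnCap` below.
-/

open scoped BigOperators Classical

/-- Arcs of the multi-commodity flow network `MFN`:
`mid i` is the arc `(i, i')`, `sx j i` is `(j^s, i)`, `gs i j` is `(i, j^s)`,
and `ft i j` is `(i', j^t)`. -/
inductive MFNArc (F D : Type) where
  | mid : F → MFNArc F D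
  | sx  : D → F → MFNArc F D
  | gs  : F → D → MFNArc F D
  | ft  : F → D → MFNArc F D
  deriving DecidableEq, Fintype

/-- Nodes of the multi-commodity flow network `MFN`. -/
inductive MFNNode (F D : Type) where
  | src  : D → MFNNode F D
  | fac  : F → MFNNode F D
  | fac' : F → MFNNode F D
  | sink : D → MFNNode F D
  deriving DecidableEq

variable {F D : Type}

/-- Tail (start node) of an arc. -/
def MFNArc.tail : MFNArc F D → MFNNode F D
  | .mid i => .fac i
  | .sx j _ => .src j
  | .gs i _ => .fac i
  | .ft i _ => .fac' i

/-- Head (end node) of an arc. -/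
def MFNArc.head : MFNArc F D → MFNNode F D
  | .mid i => .fac' i
  | .sx _ i => .fac i
  | .gs _ j => .src j
  | .ft _ j => .sink j

variable [Fintype F] [Fintype D]

/-- Capacity of each arc of `MFN(g, x, y)`; the demand of client `j` is
`d j = 1 - ∑ i, g i j`. -/
noncomputable def mfnCap (U : F → ℕ) (g x : F → D → ℝ) (y : F → ℝ) : MFNArc F D → ℝ
  | .mid i  => y i * ((U i : ℝ) - ∑ j, g i j)
  | .sx j i => x i j
  | .gs i j => g i j
  | .ft i j => y i * (1 - ∑ i', g i' j)

/-- Net outflow of a (single-commodity) flow `f` at node `v`. -/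
noncomputable def netOutflow (f : MFNArc F D → ℝ) (v : MFNNode F D) : ℝ :=
  ∑ a ∈ Finset.univ.filter (fun a : MFNArc F D => a.tail = v), f a -
    ∑ a ∈ Finset.univ.filter (fun a : MFNArc F D => a.head = v), f a

/-- `f = (f_j)_{j ∈ D}` is a feasible multi-commodity flow for `MFN(g, x, y)`:
each `f_j` is nonnegative, conserves flow at every node other than `j^s` and `j^t`,
has net outflow `d j = 1 - ∑ i, g i j` at `j^s`, and the total flow on every arc is
at most its capacity. -/
def IsFeasibleFlow (U : F → ℕ) (g x : F → D → ℝ) (y : F → ℝ)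
    (f : D → MFNArc F D → ℝ) : Prop :=
  (∀ j a, 0 ≤ f j a) ∧
  (∀ (j : D) (v : MFNNode F D), v ≠ MFNNode.src j → v ≠ MFNNode.sink j →
      netOutflow (f j) v = 0) ∧
  (∀ j : D, netOutflow (f j) (MFNNode.src j) = 1 - ∑ i, g i j) ∧
  (∀ a : MFNArc F D, ∑ j, f j a ≤ mfnCap U g x y a)

/-- The multi-commodity flow network `MFN(g, x, y)` is feasible. -/
def MFNFeasible (U : F → ℕ) (g x : F → D → ℝ) (y : F → ℝ) : Prop :=
  ∃ f : D → MFNArc F D → ℝ, IsFeasibleFlow U g x y f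

/-- `g` is a valid partial (fractional) assignment of clients to facilities. -/
def ValidAssign (U : F → ℕ) (g : F → D → ℝ) : Prop :=
  (∀ i j, 0 ≤ g i j) ∧ (∀ j, ∑ i, g i j ≤ 1) ∧ (∀ i, ∑ j, g i j ≤ (U i : ℝ))

/-- `IsMFNPath u v P` holds when `P` is a list of arcs forming a directed path from
node `u` to node `v` in the (fixed) underlying digraph of the flow network. -/
inductive IsMFNPath : MFNNode F D → MFNNode F D → List (MFNArc F D) → Prop
  | nil (v : MFNNode F D) : IsMFNPath v v []
  | cons (a : MFNArc F D) (w : MFNNode F D) (P : List (MFNArc F D)) :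
      IsMFNPath a.head w P → IsMFNPath a.tail w (a :: P)

instance : Finite (MFNNode F D) := by
  refine Finite.of_injective (β := (D ⊕ F) ⊕ (F ⊕ D)) (fun v => match v with
    | .src j => .inl (.inl j)
    | .fac i => .inl (.inr i)
    | .fac' i => .inr (.inl i)
    | .sink j => .inr (.inr j)) ?_
  intro v w h
  cases v <;> cases w <;> simp_all

noncomputable instance : Fintype (MFNNode F D) := Fintype.ofFinite _

/-- Summation by parts: pairing net outflows with a potential amounts to pairing the flow
with the potential drops along arcs. -/
lemma sum_netOutflow_mul (f : MFNArc F D → ℝ) (p : MFNNode F D → ℝ) :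
    ∑ v, netOutflow f v * p v = ∑ a, f a * (p a.tail - p a.head) := by
  have key (h : MFNArc F D → MFNNode F D) :
      ∑ v, (∑ a ∈ Finset.univ.filter (fun a => h a = v), f a) * p v = ∑ a, f a * p (h a) := by
    rw [← Finset.sum_fiberwise (s := Finset.univ) (g := h)]
    refine Finset.sum_congr rfl fun v _ => ?_
    rw [Finset.sum_mul]
    refine Finset.sum_congr rfl fun a ha => ?_
    rw [(Finset.mem_filter.mp ha).2]
  simp only [netOutflow, sub_mul, Finset.sum_sub_distrib, mul_sub, key]

/-- The net outflows of all commodities `j` at all nodes other than the sink of `j`. -/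
noncomputable def netOutflowMap :
    (D → MFNArc F D → ℝ) →ₗ[ℝ] (D × MFNNode F D → ℝ) where
  toFun f q := if q.2 = MFNNode.sink q.1 then 0 else netOutflow (f q.1) q.2
  map_add' f f' := by
    ext q
    by_cases h : q.2 = MFNNode.sink q.1
    · simp [h]
    · simp only [h, if_false, netOutflow, Pi.add_apply, Finset.sum_add_distrib]
      ring
  map_smul' r f := by
    ext q
    by_cases h : q.2 = MFNNode.sink q.1
    · simp [h]
    · simp only [h, if_false, netOutflow, Pi.smul_apply, smul_eq_mul, ← Finset.mul_sum,
        RingHom.id_apply, mul_sub]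

lemma netOutflowMap_apply (f : D → MFNArc F D → ℝ) (q : D × MFNNode F D) :
    netOutflowMap f q = if q.2 = MFNNode.sink q.1 then 0 else netOutflow (f q.1) q.2 := rfl

/-- Multi-commodity flows within the capacities `c`, with no conservation requirement. -/
def boundedFlows (c : MFNArc F D → ℝ) : Set (D → MFNArc F D → ℝ) :=
  {f | (∀ j a, 0 ≤ f j a) ∧ ∀ a, ∑ j, f j a ≤ c a}

omit [Fintype F] in
lemma convex_boundedFlows (c : MFNArc F D → ℝ) : Convex ℝ (boundedFlows c) := by
  rintro f ⟨hf, hfc⟩ f' ⟨hf', hfc'⟩ r s hr hs hrs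
  refine ⟨fun j a => add_nonneg (mul_nonneg hr (hf j a)) (mul_nonneg hs (hf' j a)), fun a => ?_⟩
  calc ∑ j, (r • f + s • f') j a = r * ∑ j, f j a + s * ∑ j, f' j a := by
        simp [Finset.sum_add_distrib, Finset.mul_sum]
    _ ≤ r * c a + s * c a := by gcongr; exacts [hfc a, hfc' a]
    _ = c a := by rw [← add_mul, hrs, one_mul]

omit [Fintype F] in
lemma isCompact_boundedFlows (c : MFNArc F D → ℝ) : IsCompact (boundedFlows c) := by
  refine (isCompact_Icc (a := fun (_ : D) (_ : MFNArc F D) => (0 : ℝ))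
    (b := fun _ a => c a)).of_isClosed_subset ?_ ?_
  · refine IsClosed.inter (s₁ := {f : D → MFNArc F D → ℝ | ∀ j a, 0 ≤ f j a})
      (s₂ := {f | ∀ a, ∑ j, f j a ≤ c a}) ?_ ?_
    · simp only [Set.ofPred_forall]
      exact isClosed_iInter fun j => isClosed_iInter fun a =>
        isClosed_le continuous_const (by fun_prop)
    · simp only [Set.ofPred_forall]
      exact isClosed_iInter fun a => isClosed_le (by fun_prop) continuous_const
  · rintro f ⟨hf, hfc⟩
    exact ⟨fun j a => hf j a, fun j a => (Finset.single_le_sum (f := fun j => f j a)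
      (fun j _ => hf j a) (Finset.mem_univ j)).trans (hfc a)⟩

/-- The least nonnegative arc lengths that dominate the drops of all the potentials `p j`. -/
noncomputable def maxDrop (p : D → MFNNode F D → ℝ) (a : MFNArc F D) : ℝ :=
  ⨆ j, max 0 (p j a.tail - p j a.head)

omit [Fintype F] in
lemma drop_le_maxDrop (p : D → MFNNode F D → ℝ) (j : D) (a : MFNArc F D) :
    p j a.tail - p j a.head ≤ maxDrop p a :=
  (le_max_right _ _).trans
    (le_ciSup (f := fun j => max 0 (p j a.tail - p j a.head)) (Set.finite_range _).bddAbove j)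

omit [Fintype F] [Fintype D] in
lemma maxDrop_nonneg (p : D → MFNNode F D → ℝ) (a : MFNArc F D) : 0 ≤ maxDrop p a :=
  Real.iSup_nonneg fun _ => le_max_left _ _

/-- Routing, on every arc, the whole capacity to a commodity of maximal drop. -/
lemma exists_boundedFlow_sum_eq (c : MFNArc F D → ℝ) (hc : ∀ a, 0 ≤ c a)
    (p : D → MFNNode F D → ℝ) :
    ∃ f ∈ boundedFlows c,
      ∑ j, ∑ a, f j a * (p j a.tail - p j a.head) = ∑ a, c a * maxDrop p a := by
  have key (a : MFNArc F D) : ∃ u : D → ℝ, (∀ j, 0 ≤ u j) ∧ ∑ j, u j ≤ c a ∧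
      ∑ j, u j * (p j a.tail - p j a.head) = c a * maxDrop p a := by
    by_cases h : maxDrop p a = 0
    · exact ⟨0, by simp, by simpa using hc a, by simp [h]⟩
    · have : Nonempty D := by
        by_contra hD
        rw [not_nonempty_iff] at hD
        exact h (Real.iSup_of_isEmpty _)
      obtain ⟨k, hk⟩ := exists_eq_ciSup_of_finite (f := fun j => max 0 (p j a.tail - p j a.head))
      change max 0 (p k a.tail - p k a.head) = maxDrop p a at hk
      have hk' : p k a.tail - p k a.head = maxDrop p a := by
        rcases max_choice 0 (p k a.tail - p k a.head) with h0 | h0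
        · exact absurd (hk.symm.trans h0) h
        · exact h0.symm.trans hk
      refine ⟨Pi.single k (c a), fun j => ?_, by simp, ?_⟩
      · exact (Pi.single_nonneg.mpr (hc a) : (0 : D → ℝ) ≤ _) j
      · simp [Pi.single_apply, hk']
  choose u hu huc hup using key
  refine ⟨fun j a => u a j, ⟨fun j a => hu a j, huc⟩, ?_⟩
  rw [Finset.sum_comm]
  exact Finset.sum_congr rfl fun a _ => hup a

/-- Farkas-type certificate: if no flow within the capacities `c` meets the demands `d`, some
potentials, vanishing at the sinks, have a total demand value exceeding the capacity weighted
by the maximal drops. -/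
lemma exists_potential_of_infeasible (c : MFNArc F D → ℝ) (hc : ∀ a, 0 ≤ c a) (d : D → ℝ)
    (hinf : ¬ ∃ f ∈ boundedFlows c,
      (∀ j v, v ≠ MFNNode.src j → v ≠ MFNNode.sink j → netOutflow (f j) v = 0) ∧
      ∀ j, netOutflow (f j) (MFNNode.src j) = d j) :
    ∃ p : D → MFNNode F D → ℝ, (∀ j, p j (MFNNode.sink j) = 0) ∧
      ∑ a, c a * maxDrop p a < ∑ j, d j * p j (MFNNode.src j) := by
  let b : D × MFNNode F D → ℝ := fun q => if q.2 = MFNNode.src q.1 then d q.1 else 0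
  have hb : b ∉ netOutflowMap '' boundedFlows c := by
    rintro ⟨f, hf, hfb⟩
    refine hinf ⟨f, hf, fun j v hs ht => ?_, fun j => ?_⟩
    · simpa [netOutflowMap_apply, b, hs, ht] using congrFun hfb (j, v)
    · simpa [netOutflowMap_apply, b] using congrFun hfb (j, MFNNode.src j)
  obtain ⟨φ, r, hφ, hr⟩ := geometric_hahn_banach_closed_point
    ((convex_boundedFlows c).linear_image netOutflowMap)
    ((isCompact_boundedFlows c).image
      (LinearMap.continuous_of_finiteDimensional netOutflowMap)).isClosed hb
  let p : D → MFNNode F D → ℝ := fun j v =>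
    if v = MFNNode.sink j then 0 else φ (Pi.single (j, v) 1)
  have hφ_sum (w : D × MFNNode F D → ℝ) :
      φ w = ∑ j, ∑ v, w (j, v) * φ (Pi.single (j, v) 1) := by
    rw [← Fintype.sum_prod_type' (f := fun j v => w (j, v) * φ (Pi.single (j, v) 1))]
    conv_lhs => rw [pi_eq_sum_univ' w]
    simp [map_sum]
  refine ⟨p, fun j => by simp [p], ?_⟩
  obtain ⟨f, hf, hfp⟩ := exists_boundedFlow_sum_eq c hc p
  have hN : φ (netOutflowMap f) = ∑ a, c a * maxDrop p a := by
    rw [← hfp, hφ_sum]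
    refine Finset.sum_congr rfl fun j _ => ?_
    rw [← sum_netOutflow_mul]
    refine Finset.sum_congr rfl fun v _ => ?_
    by_cases h : v = MFNNode.sink j <;> simp [netOutflowMap_apply, p, h]
  have hB : φ b = ∑ j, d j * p j (MFNNode.src j) := by
    rw [hφ_sum]
    simp [b, p]
  rw [← hN, ← hB]
  exact (hφ _ ⟨f, hf, rfl⟩).trans hr

omit [Fintype F] in
/-- The potential drop between the ends of a path is at most the length of the path. -/
lemma IsMFNPath.drop_le {u v : MFNNode F D} {P : List (MFNArc F D)} (h : IsMFNPath u v P)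
    (p : D → MFNNode F D → ℝ) (j : D) : p j u - p j v ≤ (P.map (maxDrop p)).sum := by
  induction h with
  | nil v => simp
  | cons a w P _ ih =>
    have := drop_le_maxDrop p j a
    simp only [List.map_cons, List.sum_cons]
    linarith

/-- Weak duality for `MFN`. -/
lemma IsFeasibleFlow.sum_demand_mul_le {U : F → ℕ} {g x : F → D → ℝ} {y : F → ℝ}
    {f : D → MFNArc F D → ℝ} (hf : IsFeasibleFlow U g x y f) (p : D → MFNNode F D → ℝ)
    (hp : ∀ j, p j (MFNNode.sink j) = 0) :
    ∑ j, (1 - ∑ i, g i j) * p j (MFNNode.src j) ≤ ∑ a, mfnCap U g x y a * maxDrop p a := by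
  obtain ⟨hf0, hcons, hsrc, hcap⟩ := hf
  calc ∑ j, (1 - ∑ i, g i j) * p j (MFNNode.src j)
      = ∑ j, ∑ v, netOutflow (f j) v * p j v := by
        refine Finset.sum_congr rfl fun j _ => ?_
        rw [← hsrc j, Fintype.sum_eq_single (MFNNode.src j)]
        intro v hv
        by_cases h : v = MFNNode.sink j
        · rw [h, hp, mul_zero]
        · rw [hcons j v hv h, zero_mul]
    _ = ∑ j, ∑ a, f j a * (p j a.tail - p j a.head) := by simp only [sum_netOutflow_mul]
    _ ≤ ∑ j, ∑ a, f j a * maxDrop p a := by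
        gcongr with j _ a _
        · exact hf0 j a
        · exact drop_le_maxDrop p j a
    _ = ∑ a, (∑ j, f j a) * maxDrop p a := by
        rw [Finset.sum_comm]
        simp only [Finset.sum_mul]
    _ ≤ ∑ a, mfnCap U g x y a * maxDrop p a := by
        gcongr with a _
        · exact maxDrop_nonneg p a
        · exact hcap a

lemma mfnCap_nonneg {U : F → ℕ} {g x : F → D → ℝ} {y : F → ℝ} (hg : ValidAssign U g)
    (hx : ∀ i j, 0 ≤ x i j) (hy : ∀ i, 0 ≤ y i) (a : MFNArc F D) : 0 ≤ mfnCap U g x y a := by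
  obtain ⟨hg0, hg1, hgU⟩ := hg
  cases a with
  | mid i => exact mul_nonneg (hy i) (sub_nonneg.mpr (hgU i))
  | sx j i => exact hx i j
  | gs i j => exact hg0 i j
  | ft i j => exact mul_nonneg (hy i) (sub_nonneg.mpr (hg1 j))

/-- If `MFN(g*, x*, y*)` is infeasible, there is a dual certificate
`(z, ℓ)` yielding an inequality that is valid for MFNLP but violated by `(x*, y*)`. -/
theorem stmt_7 (U : F → ℕ) (hU : ∀ i, 0 < U i)
    (gstar xstar : F → D → ℝ) (ystar : F → ℝ)
    (hg : ValidAssign U gstar)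
    (hx : ∀ i j, 0 ≤ xstar i j ∧ xstar i j ≤ 1)
    (hy : ∀ i, 0 ≤ ystar i ∧ ystar i ≤ 1)
    (hinf : ¬ MFNFeasible U gstar xstar ystar) :
    ∃ (z : D → ℝ) (ℓ : MFNArc F D → ℝ),
      (∀ j, 0 ≤ z j ∧ z j ≤ 1) ∧ (∀ a, 0 ≤ ℓ a ∧ ℓ a ≤ 1) ∧
      (∀ (j : D) (P : List (MFNArc F D)),
        IsMFNPath (MFNNode.src j) (MFNNode.sink j) P → z j ≤ (P.map ℓ).sum) ∧
      (∑ a : MFNArc F D, mfnCap U gstar xstar ystar a * ℓ a <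
        ∑ j, (1 - ∑ i, gstar i j) * z j) ∧
      (∀ (x : F → D → ℝ) (y : F → ℝ),
        (∀ i j, 0 ≤ x i j ∧ x i j ≤ 1) → (∀ i, 0 ≤ y i ∧ y i ≤ 1) →
        MFNFeasible U gstar x y →
        ∑ j, (1 - ∑ i, gstar i j) * z j ≤
          ∑ a : MFNArc F D, mfnCap U gstar x y a * ℓ a) := by
  have hd (j : D) : 0 ≤ 1 - ∑ i, gstar i j := sub_nonneg.mpr (hg.2.1 j)
  have hc := mfnCap_nonneg hg (fun i j => (hx i j).1) (fun i => (hy i).1)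
  obtain ⟨p, hp, hlt⟩ := exists_potential_of_infeasible (mfnCap U gstar xstar ystar) hc
    (fun j => 1 - ∑ i, gstar i j)
    (fun ⟨f, hf, hcons, hsrc⟩ => hinf ⟨f, hf.1, hcons, hsrc, hf.2⟩)
  obtain ⟨C, hC, hpC⟩ : ∃ C : ℝ, 0 < C ∧ ∀ j v, p j v ≤ C := by
    obtain ⟨M, hM⟩ := (Set.finite_range fun q : D × MFNNode F D => p q.1 q.2).bddAbove
    exact ⟨max 1 M, by positivity, fun j v => (hM ⟨(j, v), rfl⟩).trans (le_max_right _ _)⟩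
  let q : D → MFNNode F D → ℝ := fun j v => max (p j v) 0 / C
  have hq0 (j : D) (v : MFNNode F D) : 0 ≤ q j v := by positivity
  have hq1 (j : D) (v : MFNNode F D) : q j v ≤ 1 :=
    (div_le_one hC).mpr (max_le (hpC j v) hC.le)
  have hqt (j : D) : q j (MFNNode.sink j) = 0 := by simp [q, hp]
  have hdrop (a : MFNArc F D) : maxDrop q a ≤ maxDrop p a / C := by
    refine Real.iSup_le (fun j => max_le (div_nonneg (maxDrop_nonneg p a) hC.le) ?_)
      (div_nonneg (maxDrop_nonneg p a) hC.le)
    rw [← sub_div]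
    gcongr
    have h1 := drop_le_maxDrop p j a
    have h2 := maxDrop_nonneg p a
    rw [sub_le_iff_le_add]
    refine max_le ?_ (by positivity)
    linarith [le_max_left (p j a.head) 0]
  refine ⟨fun j => q j (MFNNode.src j), maxDrop q, fun j => ⟨hq0 _ _, hq1 _ _⟩,
    fun a => ⟨maxDrop_nonneg q a, Real.iSup_le (fun j => max_le zero_le_one ?_) zero_le_one⟩,
    fun j P hP => ?_, ?_, fun x y _ _ ⟨f, hf⟩ => hf.sum_demand_mul_le q hqt⟩
  · linarith [hq1 j a.tail, hq0 j a.head]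
  · simpa [hqt] using hP.drop_le q j
  · calc ∑ a, mfnCap U gstar xstar ystar a * maxDrop q a
        ≤ ∑ a, mfnCap U gstar xstar ystar a * (maxDrop p a / C) := by
          gcongr with a _
          · exact hc a
          · exact hdrop a
      _ = (∑ a, mfnCap U gstar xstar ystar a * maxDrop p a) / C := by
          simp only [Finset.sum_div, mul_div_assoc]
      _ < (∑ j, (1 - ∑ i, gstar i j) * p j (MFNNode.src j)) / C := by gcongr
      _ = ∑ j, (1 - ∑ i, gstar i j) * (p j (MFNNode.src j) / C) := by
          simp only [Finset.sum_div, mul_div_assoc]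
      _ ≤ ∑ j, (1 - ∑ i, gstar i j) * q j (MFNNode.src j) := by
          gcongr with j _
          · exact hd j
          · exact div_le_div_of_nonneg_right (le_max_left _ _) hC.le
end

section
/- In the maximum-matching construction with partial assignment g*: if MFN(g*,x*,y') is feasible, then there exists a feasible flow f for MFN(g*,x*,y') such that every client sinks at least half its demand at facilities in S, i.e., h(S,j) ≥ d_j/2 for every j ∈ D, where d_j = 1 − Σ_{i∈F} g*_{ij}. -/
/-!
Formalization of statements from "An LP-rounding approach to capacitated facility location".

`F` is the (finite) type of facilities, `D` the type of clients, `U i` the (positive integer)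
capacity of facility `i`.  The multi-commodity flow network `MFN(g, x, y)` has nodes
`j^s, j^t` for clients `j` and `i, i'` for facilities `i`; its arcs and capacities are as in
`MFNArc` / `mfnCap` below.
-/

open scoped BigOperators Classical

variable {F D : Type}

variable [Fintype F] [Fintype D]

/-- Arcs of the residual graph `H` of the fractional `b`-matching `z`: an arc from client
`j` to facility `i ∈ I` when `z i j < 2 * x i j`, and an arc from facility `i ∈ I` to
client `j` when `z i j > 0`. -/
def HStep (I : Finset F) (z x : F → D → ℝ) : F ⊕ D → F ⊕ D → Prop
  | Sum.inr j, Sum.inl i => i ∈ I ∧ z i j < 2 * x i j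
  | Sum.inl i, Sum.inr j => i ∈ I ∧ 0 < z i j
  | _, _ => False

/-- Client `j` is unsaturated by the fractional matching `z`. -/
def Unsat (I : Finset F) (z : F → D → ℝ) (j : D) : Prop :=
  ∑ i ∈ I, z i j ≠ 1

/-- Facility `i` belongs to `I_H`: it is reachable in `H` from some unsaturated client. -/
def InIH (I : Finset F) (z x : F → D → ℝ) (i : F) : Prop :=
  ∃ k : D, Unsat I z k ∧ Relation.ReflTransGen (HStep I z x) (Sum.inr k) (Sum.inl i)

/-- Client `j` belongs to `D_H`: it is reachable in `H` from some unsaturated client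
(every unsaturated client itself belongs to `D_H`). -/
def InDH (I : Finset F) (z x : F → D → ℝ) (j : D) : Prop :=
  ∃ k : D, Unsat I z k ∧ Relation.ReflTransGen (HStep I z x) (Sum.inr k) (Sum.inr j)

namespace MFN

set_option linter.unusedSectionVars false

open Finset Relation Filter Topology

/-- Signed incidence of an arc at a node. -/
noncomputable def inc (a : MFNArc F D) (v : MFNNode F D) : ℝ :=
  (if a.tail = v then 1 else 0) - (if a.head = v then 1 else 0)

noncomputable instance : Fintype (MFNNode F D) :=
  Fintype.ofInjective
    (fun v : MFNNode F D => match v with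
      | .src j => (Sum.inl (Sum.inl j) : (D ⊕ F) ⊕ (F ⊕ D))
      | .fac i => Sum.inl (Sum.inr i)
      | .fac' i => Sum.inr (Sum.inl i)
      | .sink j => Sum.inr (Sum.inr j))
    (by intro u v h; cases u <;> cases v <;> simp_all)

lemma netOutflow_eq (f : MFNArc F D → ℝ) (v : MFNNode F D) :
    netOutflow f v = ∑ a, f a * inc a v := by
  simp only [netOutflow, inc, sum_filter, mul_sub, sum_sub_distrib, mul_ite, mul_one, mul_zero]

lemma netOutflow_add (f g : MFNArc F D → ℝ) (v : MFNNode F D) :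
    netOutflow (f + g) v = netOutflow f v + netOutflow g v := by
  simp only [netOutflow_eq, Pi.add_apply, add_mul, sum_add_distrib]

lemma netOutflow_smul (c : ℝ) (f : MFNArc F D → ℝ) (v : MFNNode F D) :
    netOutflow (c • f) v = c * netOutflow f v := by
  simp only [netOutflow_eq, Pi.smul_apply, smul_eq_mul, mul_assoc, mul_sum]

lemma netOutflow_neg (f : MFNArc F D → ℝ) (v : MFNNode F D) :
    netOutflow (-f) v = -netOutflow f v := by
  simp only [netOutflow_eq, Pi.neg_apply, neg_mul, sum_neg_distrib]

lemma netOutflow_sub (f g : MFNArc F D → ℝ) (v : MFNNode F D) :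
    netOutflow (f - g) v = netOutflow f v - netOutflow g v := by
  rw [sub_eq_add_neg, netOutflow_add, netOutflow_neg, sub_eq_add_neg]

lemma netOutflow_zero (v : MFNNode F D) : netOutflow (0 : MFNArc F D → ℝ) v = 0 := by
  simp [netOutflow]

lemma netOutflow_single (a : MFNArc F D) (v : MFNNode F D) :
    netOutflow (Pi.single a 1) v = inc a v := by
  simp [netOutflow_eq, Pi.single_apply]

/-- Net outflow of a set of nodes, counted arc by arc. -/
lemma sum_netOutflow (f : MFNArc F D → ℝ) (X : Set (MFNNode F D)) :
    ∑ v, (if v ∈ X then netOutflow f v else 0) =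
      ∑ a, f a * ((if a.tail ∈ X then 1 else 0) - (if a.head ∈ X then 1 else 0)) := by
  simp only [netOutflow_eq, ← sum_filter]
  rw [sum_comm]
  refine sum_congr rfl fun a _ => ?_
  rw [← mul_sum]
  simp [inc, sum_sub_distrib]

/-- A sum over arcs, split by the kind of arc. -/
lemma sum_arc (f : MFNArc F D → ℝ) :
    ∑ a, f a = (∑ i, f (.mid i) + ∑ j, ∑ i, f (.sx j i)) +
      (∑ i, ∑ j, f (.gs i j) + ∑ i, ∑ j, f (.ft i j)) := by
  let e : (F ⊕ D × F) ⊕ (F × D ⊕ F × D) ≃ MFNArc F D :=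
    { toFun := fun s => match s with
        | .inl (.inl i) => .mid i
        | .inl (.inr p) => .sx p.1 p.2
        | .inr (.inl p) => .gs p.1 p.2
        | .inr (.inr p) => .ft p.1 p.2
      invFun := fun a => match a with
        | .mid i => .inl (.inl i)
        | .sx j i => .inl (.inr (j, i))
        | .gs i j => .inr (.inl (i, j))
        | .ft i j => .inr (.inr (i, j))
      left_inv := by rintro ((i | p) | (p | p)) <;> rfl
      right_inv := by rintro (i | ⟨j, i⟩ | ⟨i, j⟩ | ⟨i, j⟩) <;> rfl }
  rw [← e.sum_comp]
  simp only [Fintype.sum_sum_type, Fintype.sum_prod_type]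
  rfl

lemma netOutflow_sink (f : MFNArc F D → ℝ) (j : D) :
    netOutflow f (.sink j) = -∑ i, f (.ft i j) := by
  simp [netOutflow_eq, sum_arc, inc, MFNArc.tail, MFNArc.head]

lemma netOutflow_fac' (f : MFNArc F D → ℝ) (i : F) :
    netOutflow f (.fac' i) = ∑ j, f (.ft i j) - f (.mid i) := by
  simp [netOutflow_eq, sum_arc, inc, MFNArc.tail, MFNArc.head]
  ring

/-- One step along an arc that carries positive flow. -/
def FlowStep (f : MFNArc F D → ℝ) (u v : MFNNode F D) : Prop :=
  ∃ a, 0 < f a ∧ a.tail = u ∧ a.head = v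

lemma flowStep {f : MFNArc F D → ℝ} {a : MFNArc F D} (h : 0 < f a) :
    FlowStep f a.tail a.head := ⟨a, h, rfl, rfl⟩

/-- `δ` is a unit flow from `u` to `v` carried by the support of `f`. -/
structure UnitFlow (f δ : MFNArc F D → ℝ) (u v : MFNNode F D) : Prop where
  nonneg : ∀ a, 0 ≤ δ a
  supp : ∀ a, f a = 0 → δ a = 0
  net : ∀ w, netOutflow δ w = (if w = u then 1 else 0) - (if w = v then 1 else 0)

lemma exists_unitFlow {f : MFNArc F D → ℝ} {u v : MFNNode F D}
    (h : ReflTransGen (FlowStep f) u v) : ∃ δ, UnitFlow f δ u v := by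
  induction h with
  | refl => exact ⟨0, fun _ => le_rfl, fun _ _ => rfl, fun w => by simp [netOutflow_zero]⟩
  | tail _ hs ih =>
    obtain ⟨δ, h1, h2, h3⟩ := ih
    obtain ⟨a, ha, rfl, rfl⟩ := hs
    refine ⟨δ + Pi.single a 1, fun b => ?_, fun b hb => ?_, fun w => ?_⟩
    · have : (0 : ℝ) ≤ (Pi.single a 1 : MFNArc F D → ℝ) b := by
        rw [Pi.single_apply]; split_ifs <;> norm_num
      exact add_nonneg (h1 b) this
    · have : b ≠ a := by rintro rfl; exact ha.ne' hb
      simp [h2 b hb, this]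
    · rw [netOutflow_add, netOutflow_single, h3, inc]
      simp only [eq_comm (a := w)]
      ring

lemma UnitFlow.ft_eq_zero {f δ : MFNArc F D → ℝ} {u v : MFNNode F D}
    (h : UnitFlow f δ u v) (hu : ∀ j, u ≠ .sink j) (hv : ∀ j, v ≠ .sink j) (i : F) (j : D) :
    δ (.ft i j) = 0 := by
  have h0 := h.net (.sink j)
  rw [netOutflow_sink, if_neg (hu j).symm, if_neg (hv j).symm, sub_zero, neg_eq_zero,
    sum_eq_zero_iff_of_nonneg fun i _ => h.nonneg _] at h0
  exact h0 i (mem_univ i)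

/-- A node from which the support of a flow reaches the sink is itself reached from the
source. -/
lemma reach_of_reach_sink {f : MFNArc F D → ℝ} {k : D} (hf : ∀ a, 0 ≤ f a)
    (hnet : ∀ v : MFNNode F D, v ≠ .src k → v ≠ .sink k → netOutflow f v = 0)
    {v : MFNNode F D} (hv : v ≠ .sink k) (h : ReflTransGen (FlowStep f) v (.sink k)) :
    ReflTransGen (FlowStep f) (.src k) v := by
  by_contra hsrc
  let X : Set (MFNNode F D) := {u | ReflTransGen (FlowStep f) u v}
  have hsink : (MFNNode.sink k : MFNNode F D) ∉ X := by
    intro hX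
    rcases ReflTransGen.cases_head hX with h1 | ⟨c, ⟨a, _, h1, _⟩, _⟩
    · exact hv h1.symm
    · cases a <;> simp [MFNArc.tail] at h1
  have hcut := sum_netOutflow f X
  have hclosed : ∀ a, 0 < f a → a.head ∈ X → a.tail ∈ X :=
    fun a ha hX => ReflTransGen.head (flowStep ha) hX
  rw [sum_eq_zero, eq_comm, sum_eq_zero_iff_of_nonneg] at hcut
  · refine hsink (?_ : MFNNode.sink k ∈ X)
    clear hsink
    have : ∀ w, ReflTransGen (FlowStep f) v w → w ∈ X := by
      intro w hw
      induction hw with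
      | refl => exact ReflTransGen.refl
      | tail _ hs ih =>
        obtain ⟨a, ha, rfl, rfl⟩ := hs
        by_contra hX
        have := hcut a (mem_univ a)
        rw [if_pos ih, if_neg hX] at this
        linarith
    exact this _ h
  · intro a _
    rcases (hf a).eq_or_lt with h0 | h0
    · simp [← h0]
    · by_cases h1 : a.head ∈ X
      · simp [h1, hclosed a h0 h1]
      · rw [if_neg h1]
        exact mul_nonneg h0.le (by split_ifs <;> norm_num)
  · intro w _
    split_ifs with hw
    · refine hnet w ?_ ?_
      · rintro rfl; exact hsrc hw
      · rintro rfl; exact hsink hw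
    · rfl

section Feasible

variable {U : F → ℕ} {g x : F → D → ℝ} {y : F → ℝ} {f : D → MFNArc F D → ℝ}

lemma ft_eq_zero {f : MFNArc F D → ℝ} {k : D} (hf : ∀ a, 0 ≤ f a)
    (hnet : ∀ v : MFNNode F D, v ≠ .src k → v ≠ .sink k → netOutflow f v = 0)
    {j : D} (hjk : j ≠ k) (i : F) : f (.ft i j) = 0 := by
  have h0 := hnet (.sink j) (by simp) (by simpa using hjk)
  rw [netOutflow_sink, neg_eq_zero, sum_eq_zero_iff_of_nonneg fun i _ => hf _] at h0
  exact h0 i (mem_univ i)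

lemma mid_eq_ft {f : MFNArc F D → ℝ} {k : D} (hf : ∀ a, 0 ≤ f a)
    (hnet : ∀ v : MFNNode F D, v ≠ .src k → v ≠ .sink k → netOutflow f v = 0) (i : F) :
    f (.mid i) = f (.ft i k) := by
  have h0 := hnet (.fac' i) (by simp) (by simp)
  rw [netOutflow_fac', sum_eq_single k (fun j _ hj => ft_eq_zero hf hnet hj i) (by simp)] at h0
  linarith

lemma sum_ft {f : MFNArc F D → ℝ} {k : D}
    (hnet : ∀ v : MFNNode F D, v ≠ .src k → v ≠ .sink k → netOutflow f v = 0) :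
    ∑ i, f (.ft i k) = netOutflow f (.src k) := by
  have h0 := sum_netOutflow f Set.univ
  simp only [Set.mem_univ, if_true, sub_self, mul_zero, sum_const_zero] at h0
  rw [Fintype.sum_eq_add (.src k) (.sink k) (by simp) (fun v hv => hnet v hv.1 hv.2),
    netOutflow_sink] at h0
  linarith

/-- Commodity `k` is sunk in `I` along a walk through the client `l`. -/
def Exits (I : Finset F) (f : MFNArc F D → ℝ) (k l : D) : Prop :=
  ReflTransGen (FlowStep f) (.src k) (.src l) ∧
    ∃ i ∈ I, ReflTransGen (FlowStep f) (.src l) (.fac' i) ∧ 0 < f (.ft i k)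

/-- A perturbation `Δ` of `f` that diverts one unit of commodity `j₀` so that it ends at the
client `l`, and frees the unit flow `τ` from `l` to `I`. -/
structure Shift (I : Finset F) (f : D → MFNArc F D → ℝ) (j₀ l : D)
    (Δ : D → MFNArc F D → ℝ) (τ : MFNArc F D → ℝ) (i₀ : F) : Prop where
  mem : i₀ ∈ I
  pos : ∀ k a, f k a = 0 → 0 ≤ Δ k a
  net : ∀ k v, v ≠ .sink k → netOutflow (Δ k) v = if k = j₀ ∧ v = .src l then -1 else 0
  total : ∀ a, (∀ i j, a ≠ .ft i j) → ∑ k, Δ k a = -τ a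
  ft : ∀ i ∉ I, ∀ k j, Δ k (.ft i j) = 0
  nonneg : ∀ a, 0 ≤ τ a
  ft' : ∀ i j, τ (.ft i j) = 0
  netτ : ∀ w, netOutflow τ w = (if w = .src l then 1 else 0) - (if w = .fac' i₀ then 1 else 0)

lemma single_nonneg (a b : MFNArc F D) : 0 ≤ (Pi.single a 1 : MFNArc F D → ℝ) b := by
  rw [Pi.single_apply]; split_ifs <;> norm_num

lemma single_supp {f : MFNArc F D → ℝ} {a b : MFNArc F D} (ha : 0 < f a) (hb : f b = 0) :
    (Pi.single a 1 : MFNArc F D → ℝ) b = 0 := by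
  rw [Pi.single_apply, if_neg]; rintro rfl; exact ha.ne' hb

lemma Exits.shift {I : Finset F} {j₀ l : D} (h : Exits I (f j₀) j₀ l) :
    ∃ Δ τ i₀, Shift I f j₀ l Δ τ i₀ := by
  obtain ⟨_, i₀, hi₀, hr, hpos⟩ := h
  obtain ⟨τ, hτ⟩ := exists_unitFlow hr
  refine ⟨fun k => if k = j₀ then -τ - Pi.single (.ft i₀ j₀) 1 else 0, τ, i₀, hi₀, ?_, ?_, ?_, ?_,
    hτ.nonneg, hτ.ft_eq_zero (by simp) (by simp), hτ.net⟩
  · intro k a hk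
    split_ifs with hkj
    · subst hkj
      simp [hτ.supp a hk, single_supp hpos hk]
    · exact le_rfl
  · intro k v hv
    by_cases hkj : k = j₀
    · subst hkj
      rw [if_pos rfl, netOutflow_sub, netOutflow_neg, hτ.net, netOutflow_single]
      simp only [inc, MFNArc.tail, MFNArc.head, true_and, eq_comm (b := v),
        if_neg hv]
      split_ifs <;> norm_num
    · simp [hkj, netOutflow_zero]
  · intro a ha
    rw [Fintype.sum_eq_single j₀ (fun k hk => by simp [hk])]
    simp [ha]
  · intro i hi k j
    have : i ≠ i₀ := by rintro rfl; exact hi hi₀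
    split_ifs
    · simp [this, hτ.ft_eq_zero (by simp) (by simp)]
    · rfl

lemma Shift.step {I : Finset F} {j₀ l l' : D} {Δ : D → MFNArc F D → ℝ} {τ : MFNArc F D → ℝ}
    {i₀ : F} (h : Shift I f j₀ l Δ τ i₀) (he : Exits I (f l) l l') :
    ∃ Δ' τ' i₁, Shift I f j₀ l' Δ' τ' i₁ := by
  obtain ⟨hr', i₁, hi₁, hr, hpos⟩ := he
  obtain ⟨σ, hσ⟩ := exists_unitFlow hr'
  obtain ⟨τ', hτ'⟩ := exists_unitFlow hr
  refine ⟨fun k => Δ k + (if k = j₀ then σ else 0) +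
    (if k = l then τ + Pi.single (.ft i₀ l) 1 - σ - τ' - Pi.single (.ft i₁ l) 1 else 0),
    τ', i₁, hi₁, ?_, ?_, ?_, ?_,
    hτ'.nonneg, hτ'.ft_eq_zero (by simp) (by simp), hτ'.net⟩
  · intro k a hk
    have h1 := h.pos k a hk
    have h2 : 0 ≤ (if k = j₀ then σ else 0 : MFNArc F D → ℝ) a := by
      split_ifs
      · exact hσ.nonneg a
      · exact le_rfl
    have h3 : 0 ≤ (if k = l then τ + Pi.single (.ft i₀ l) 1 - σ - τ' - Pi.single (.ft i₁ l) 1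
        else 0 : MFNArc F D → ℝ) a := by
      split_ifs with hkl
      · subst hkl
        have := h.nonneg a
        have := single_nonneg (.ft i₀ k) a
        simp only [Pi.sub_apply, Pi.add_apply, hσ.supp a hk, hτ'.supp a hk, single_supp hpos hk]
        linarith
      · exact le_rfl
    exact add_nonneg (add_nonneg h1 h2) h3
  · intro k v hv
    have h1 : netOutflow (if k = j₀ then σ else 0 : MFNArc F D → ℝ) v =
        if k = j₀ then (if v = .src l then 1 else 0) - (if v = .src l' then 1 else 0) else 0 := by
      split_ifs <;> simp_all [hσ.net, netOutflow_zero]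
    have h2 : netOutflow (if k = l then τ + Pi.single (.ft i₀ l) 1 - σ - τ' -
        Pi.single (.ft i₁ l) 1 else 0 : MFNArc F D → ℝ) v = 0 := by
      split_ifs with hkl
      · subst hkl
        simp only [netOutflow_sub, netOutflow_add, netOutflow_single, h.netτ, hσ.net, hτ'.net,
          inc, MFNArc.tail, MFNArc.head, eq_comm (b := v), if_neg hv]
        ring
      · exact netOutflow_zero v
    rw [netOutflow_add, netOutflow_add, h.net k v hv, h1, h2]
    split_ifs <;> simp_all
  · intro a ha
    have h1 : ∑ k, (if k = j₀ then σ else 0 : MFNArc F D → ℝ) a = σ a := by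
      rw [Fintype.sum_eq_single j₀ (fun k hk => by simp [hk])]; simp
    have h2 : ∑ k, (if k = l then τ + Pi.single (.ft i₀ l) 1 - σ - τ' -
        Pi.single (.ft i₁ l) 1 else 0 : MFNArc F D → ℝ) a = τ a - σ a - τ' a := by
      rw [Fintype.sum_eq_single l (fun k hk => by simp [hk])]; simp [ha]
    simp only [Pi.add_apply, sum_add_distrib]
    rw [h.total a ha, h1, h2]
    ring
  · intro i hi k j
    have hne : i ≠ i₀ := by rintro rfl; exact hi h.mem
    have hne' : i ≠ i₁ := by rintro rfl; exact hi hi₁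
    have e1 := h.ft i hi k j
    have e2 := hσ.ft_eq_zero (by simp) (by simp) i j
    have e3 := hτ'.ft_eq_zero (by simp) (by simp) i j
    have e4 := h.ft' i j
    split_ifs <;> simp [e1, e2, e3, e4, hne, hne']

lemma Shift.close {I : Finset F} {j₀ l : D} {Δ : D → MFNArc F D → ℝ} {τ : MFNArc F D → ℝ}
    {i₀ : F} (h : Shift I f j₀ l Δ τ i₀) {s : F}
    (hr : ReflTransGen (FlowStep (f l)) (.src l) (.fac' s)) (hpos : 0 < f l (.ft s l)) :
    ∃ Δ' : D → MFNArc F D → ℝ,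
      (∀ k a, f k a = 0 → 0 ≤ Δ' k a) ∧
      (∀ k v, v ≠ .sink k → netOutflow (Δ' k) v = 0) ∧
      (∀ a, (∀ i j, a ≠ .ft i j) → ∑ k, Δ' k a = 0) ∧
      (∀ i ∉ I, ∀ k j, Δ' k (.ft i j) =
        (if i = s ∧ k = j₀ ∧ j = j₀ then 1 else 0) -
          (if i = s ∧ k = l ∧ j = l then 1 else 0)) := by
  obtain ⟨σ, hσ⟩ := exists_unitFlow hr
  refine ⟨fun k => Δ k + (if k = j₀ then σ + Pi.single (.ft s j₀) 1 else 0) +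
    (if k = l then τ + Pi.single (.ft i₀ l) 1 - σ - Pi.single (.ft s l) 1 else 0),
    ?_, ?_, ?_, ?_⟩
  · intro k a hk
    have h1 := h.pos k a hk
    have h2 : 0 ≤ (if k = j₀ then σ + Pi.single (.ft s j₀) 1 else 0 : MFNArc F D → ℝ) a := by
      split_ifs
      · exact add_nonneg (hσ.nonneg a) (single_nonneg _ _)
      · exact le_rfl
    have h3 : 0 ≤ (if k = l then τ + Pi.single (.ft i₀ l) 1 - σ - Pi.single (.ft s l) 1
        else 0 : MFNArc F D → ℝ) a := by
      split_ifs with hkl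
      · subst hkl
        have := h.nonneg a
        have := single_nonneg (.ft i₀ k) a
        simp only [Pi.sub_apply, Pi.add_apply, hσ.supp a hk, single_supp hpos hk]
        linarith
      · exact le_rfl
    exact add_nonneg (add_nonneg h1 h2) h3
  · intro k v hv
    have h1 : netOutflow (if k = j₀ then σ + Pi.single (.ft s j₀) 1 else 0 : MFNArc F D → ℝ) v =
        if k = j₀ then (if v = .src l then 1 else 0) else 0 := by
      split_ifs with hkj hvl
      all_goals first
        | exact netOutflow_zero v
        | skip
      all_goals
        subst hkj
        simp only [netOutflow_add, netOutflow_single, hσ.net,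
          inc, MFNArc.tail, MFNArc.head, eq_comm (b := v), if_neg hv]
        simp_all
    have h2 : netOutflow (if k = l then τ + Pi.single (.ft i₀ l) 1 - σ -
        Pi.single (.ft s l) 1 else 0 : MFNArc F D → ℝ) v = 0 := by
      split_ifs with hkl
      · subst hkl
        simp only [netOutflow_sub, netOutflow_add, netOutflow_single, h.netτ, hσ.net,
          inc, MFNArc.tail, MFNArc.head, eq_comm (b := v), if_neg hv]
        ring
      · exact netOutflow_zero v
    rw [netOutflow_add, netOutflow_add, h.net k v hv, h1, h2]
    split_ifs <;> simp_all
  · intro a ha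
    have h1 : ∑ k, (if k = j₀ then σ + Pi.single (.ft s j₀) 1 else 0 : MFNArc F D → ℝ) a =
        σ a := by
      rw [Fintype.sum_eq_single j₀ (fun k hk => by simp [hk])]; simp [ha]
    have h2 : ∑ k, (if k = l then τ + Pi.single (.ft i₀ l) 1 - σ -
        Pi.single (.ft s l) 1 else 0 : MFNArc F D → ℝ) a = τ a - σ a := by
      rw [Fintype.sum_eq_single l (fun k hk => by simp [hk])]; simp [ha]
    simp only [Pi.add_apply, sum_add_distrib]
    rw [h.total a ha, h1, h2]
    ring
  · intro i hi k j
    have hne : i ≠ i₀ := by rintro rfl; exact hi h.mem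
    have e1 := h.ft i hi k j
    have e2 := hσ.ft_eq_zero (by simp) (by simp) i j
    have e4 := h.ft' i j
    have h1 : (if k = j₀ then σ + Pi.single (.ft s j₀) 1 else 0 : MFNArc F D → ℝ) (.ft i j) =
        if i = s ∧ k = j₀ ∧ j = j₀ then 1 else 0 := by
      by_cases hk : k = j₀ <;> simp [hk, e2, Pi.single_apply]
    have h2 : (if k = l then τ + Pi.single (.ft i₀ l) 1 - σ - Pi.single (.ft s l) 1
        else 0 : MFNArc F D → ℝ) (.ft i j) = -if i = s ∧ k = l ∧ j = l then 1 else 0 := by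
      by_cases hk : k = l <;> simp [hk, e2, e4, hne, Pi.single_apply]
    simp only [Pi.add_apply]
    rw [e1, h1, h2]
    ring

/-- The structure of the network around the cut `(I \ J) ∪ (D \ C)` that follows from a maximum
`b`-matching. -/
structure CutData (U : F → ℕ) (g x : F → D → ℝ) (y : F → ℝ) (I J : Finset F) (C : Finset D) :
    Prop where
  mid : ∀ i ∈ J, y i * ((U i : ℝ) - ∑ j, g i j) = 0
  gs : ∀ i, ∀ j ∉ C, g i j ≠ 0 → i ∈ I \ J
  sx : ∀ j ∈ C, ∑ i ∈ I \ J, x i j ≤ (1 - ∑ i, g i j) / 2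
  demand : ∀ j ∉ C, 1 - ∑ i, g i j = 0
  y_eq : ∀ i ∈ I, y i = 1

lemma le_cap (hf : IsFeasibleFlow U g x y f) (k : D) (a : MFNArc F D) :
    f k a ≤ mfnCap U g x y a :=
  (single_le_sum (f := fun k => f k a) (fun k _ => hf.1 k a) (mem_univ k)).trans (hf.2.2.2 a)

lemma sum_ft_eq_demand (hf : IsFeasibleFlow U g x y f) (k : D) :
    ∑ i, f k (.ft i k) = 1 - ∑ i, g i k :=
  (sum_ft (hf.2.1 k)).trans (hf.2.2.1 k)

lemma sum_ft_commodity (hf : IsFeasibleFlow U g x y f) (i : F) (j : D) :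
    ∑ k, f k (.ft i j) = f j (.ft i j) :=
  Fintype.sum_eq_single j fun k hk => ft_eq_zero (hf.1 k) (hf.2.1 k) hk.symm i

lemma demand_nonneg (hf : IsFeasibleFlow U g x y f) (k : D) : 0 ≤ 1 - ∑ i, g i k := by
  rw [← sum_ft_eq_demand hf k]
  exact sum_nonneg fun i _ => hf.1 k _

variable {I J : Finset F} {C : Finset D}

/-- What a commodity sinks in `I` enters through clients by which it exits. -/
lemma sum_ft_le_exits (hf : IsFeasibleFlow U g x y f) (hC : CutData U g x y I J C) (k : D) :
    ∑ i ∈ I, f k (.ft i k) ≤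
      ∑ l ∈ C with Exits I (f k) k l, ∑ i ∈ I \ J, f k (.sx l i) := by
  have hnn := hf.1 k
  have hcap := le_cap hf k
  let B : Set (MFNNode F D) := {v | match v with
    | .src j => j ∉ C
    | .fac i => i ∈ I \ J
    | .fac' i => i ∈ I \ J
    | .sink _ => False}
  let R : Set (MFNNode F D) :=
    {v | ∃ i ∈ I, ReflTransGen (FlowStep (f k)) v (.fac' i) ∧ 0 < f k (.ft i k)}
  have hR : ∀ a, 0 < f k a → a.head ∈ R → a.tail ∈ R := by
    rintro a ha ⟨i, hi, h1, h2⟩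
    exact ⟨i, hi, ReflTransGen.head (flowStep ha) h1, h2⟩
  obtain ⟨X, hX⟩ : ∃ X : Set (MFNNode F D), ∀ v, v ∈ X ↔ v ∈ B ∧ v ∈ R :=
    ⟨B ∩ R, fun _ => Iff.rfl⟩
  have hcut := sum_netOutflow (f k) X
  rw [sum_eq_zero] at hcut
  swap
  · intro v _
    split_ifs with hv
    · rw [hX] at hv
      rcases v with j | i | i | j
      · by_cases hjk : j = k
        · subst hjk
          rw [hf.2.2.1, hC.demand j hv.1]
        · exact hf.2.1 k _ (by simpa using hjk) (by simp)
      · exact hf.2.1 k _ (by simp) (by simp)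
      · exact hf.2.1 k _ (by simp) (by simp)
      · exact hv.1.elim
    · rfl
  let u : MFNArc F D → ℝ := fun a => match a with
    | .mid _ => 0
    | .gs _ _ => 0
    | .ft i j => if i ∈ I ∧ j = k then f k (.ft i j) else 0
    | .sx l i => -(if (l ∈ C ∧ Exits I (f k) k l) ∧ i ∈ I \ J then f k (.sx l i) else 0)
  have hu : ∀ a, u a ≤ f k a *
      ((if a.tail ∈ X then 1 else 0) - (if a.head ∈ X then 1 else 0)) := by
    intro a
    rcases (hnn a).eq_or_lt with h0 | h0
    · rw [← h0, zero_mul]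
      rcases a with i | ⟨j, i⟩ | ⟨i, j⟩ | ⟨i, j⟩ <;> simp [u, ← h0]
    have key : (a.head ∈ X → a.tail ∈ B) → 0 ≤ f k a *
        ((if a.tail ∈ X then 1 else 0) - (if a.head ∈ X then 1 else 0)) := by
      intro h
      by_cases hh : a.head ∈ X
      · rw [if_pos hh, if_pos ((hX _).2 ⟨h hh, hR a h0 ((hX _).1 hh).2⟩)]; simp
      · rw [if_neg hh]
        exact mul_nonneg h0.le (by split_ifs <;> norm_num)
    rcases a with i | ⟨l, i⟩ | ⟨i, j⟩ | ⟨i, j⟩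
    · exact key fun h => ((hX _).1 h).1
    · by_cases hl : l ∈ C
      · by_cases hh : (MFNArc.sx l i).head ∈ X
        · have hi : i ∈ I \ J := ((hX _).1 hh).1
          obtain ⟨i₁, hi₁, h1, h2⟩ : (MFNNode.src l : MFNNode F D) ∈ R := hR _ h0 ((hX _).1 hh).2
          have hex : Exits I (f k) k l :=
            ⟨reach_of_reach_sink hnn (hf.2.1 k) (by simp) (h1.tail (flowStep h2)),
              i₁, hi₁, h1, h2⟩
          have ht : (MFNArc.sx l i).tail ∉ X := fun h => ((hX _).1 h).1 hl
          rw [if_pos hh, if_neg ht]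
          simp only [u]
          rw [if_pos ⟨⟨hl, hex⟩, hi⟩]
          simp
        · refine le_trans ?_ (key fun h => (hh h).elim)
          simp only [u, Left.neg_nonpos_iff]
          split_ifs
          · exact h0.le
          · exact le_rfl
      · refine le_trans ?_ (key fun _ => hl)
        simp only [u, Left.neg_nonpos_iff]
        split_ifs
        · exact h0.le
        · exact le_rfl
    · refine key fun h => hC.gs i j ((hX _).1 h).1 (h0.trans_le (hcap _)).ne'
    · by_cases hij : i ∈ I ∧ j = k
      · obtain ⟨hi, rfl⟩ := hij
        have hiJ : i ∉ J := by
          intro hiJ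
          have h1 := hcap (.mid i)
          rw [mid_eq_ft hnn (hf.2.1 j)] at h1
          have h2 := hC.mid i hiJ
          simp only [mfnCap] at h1
          linarith
        have ht : (MFNArc.ft i j).tail ∈ X :=
          (hX _).2 ⟨mem_sdiff.2 ⟨hi, hiJ⟩, i, hi, ReflTransGen.refl, h0⟩
        have hh : (MFNArc.ft i j).head ∉ X := fun h => ((hX _).1 h).1
        rw [if_pos ht, if_neg hh]
        simp [u, hi]
      · simp only [u, if_neg hij]
        exact key fun h => ((hX _).1 h).1.elim
  have hsum := sum_le_sum fun a (_ : a ∈ univ) => hu a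
  rw [← hcut, sum_arc] at hsum
  have h1 : ∑ i, ∑ j, u (.ft i j) = ∑ i ∈ I, f k (.ft i k) := by
    simp [u, ite_and, sum_ite_mem]
  have h2 : ∑ l, ∑ i, u (.sx l i) =
      -∑ l ∈ C with Exits I (f k) k l, ∑ i ∈ I \ J, f k (.sx l i) := by
    simp only [u, sum_neg_distrib, neg_inj]
    have hfil : C.filter (Exits I (f k) k) = univ.filter (fun l => l ∈ C ∧ Exits I (f k) k l) := by
      ext; simp
    rw [hfil, sum_filter]
    refine sum_congr rfl fun l _ => ?_
    by_cases hl : l ∈ C ∧ Exits I (f k) k l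
    · simp only [hl, true_and, and_self, if_true]
      rw [sum_ite_mem, univ_inter]
    · rw [if_neg hl]
      exact sum_eq_zero fun i _ => if_neg fun h => hl h.1
  rw [h1, h2] at hsum
  simp only [u, sum_const_zero] at hsum
  linarith

/-- The amount of its demand that a client sinks outside `I`. -/
noncomputable def sunk (I : Finset F) (f : D → MFNArc F D → ℝ) (j : D) : ℝ :=
  ∑ i ∈ Iᶜ, f j (.ft i j)

lemma exists_surplus (hf : IsFeasibleFlow U g x y f) (hC : CutData U g x y I J C) {j₀ : D}
    (hj₀ : sunk I f j₀ < (1 - ∑ i, g i j₀) / 2) :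
    ∃ l, TransGen (fun k l => Exits I (f k) k l) j₀ l ∧
      (1 - ∑ i, g i l) / 2 < sunk I f l := by
  by_contra! hno
  let R : Finset D := univ.filter (ReflTransGen (fun k l => Exits I (f k) k l) j₀)
  have hmem : ∀ l, l ∈ R ↔ ReflTransGen (fun k l => Exits I (f k) k l) j₀ l := by simp [R]
  have hle : ∀ l ∈ R, sunk I f l ≤ (1 - ∑ i, g i l) / 2 := by
    intro l hl
    rcases reflTransGen_iff_eq_or_transGen.1 ((hmem l).1 hl) with rfl | h
    · exact hj₀.le
    · exact hno l h
  have hlt : ∑ l ∈ R, sunk I f l < ∑ l ∈ R, (1 - ∑ i, g i l) / 2 :=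
    sum_lt_sum hle ⟨j₀, (hmem _).2 ReflTransGen.refl, hj₀⟩
  have hI : ∀ k, (1 - ∑ i, g i k) - sunk I f k = ∑ i ∈ I, f k (.ft i k) := by
    intro k
    rw [← sum_ft_eq_demand hf k, sunk, ← sum_add_sum_compl I]
    ring
  have h1 : ∑ k ∈ R, ∑ i ∈ I, f k (.ft i k) ≤
      ∑ k ∈ R, ∑ l ∈ C ∩ R, ∑ i ∈ I \ J, f k (.sx l i) := by
    refine sum_le_sum fun k hk => (sum_ft_le_exits hf hC k).trans ?_
    refine sum_le_sum_of_subset_of_nonneg ?_ fun l _ _ => sum_nonneg fun i _ => hf.1 k _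
    intro l hl
    rw [mem_filter] at hl
    exact mem_inter.2 ⟨hl.1, (hmem l).2 (((hmem k).1 hk).tail hl.2)⟩
  have h2 : ∑ k ∈ R, ∑ l ∈ C ∩ R, ∑ i ∈ I \ J, f k (.sx l i) ≤
      ∑ l ∈ C ∩ R, (1 - ∑ i, g i l) / 2 := by
    rw [sum_comm]
    refine sum_le_sum fun l hl => ?_
    rw [sum_comm]
    refine (sum_le_sum fun i _ => ?_).trans (hC.sx l (mem_inter.1 hl).1)
    exact (sum_le_sum_of_subset_of_nonneg (subset_univ R) fun k _ _ => hf.1 k _).trans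
      (hf.2.2.2 (.sx l i))
  have h3 : ∑ l ∈ C ∩ R, (1 - ∑ i, g i l) / 2 ≤ ∑ l ∈ R, (1 - ∑ i, g i l) / 2 :=
    sum_le_sum_of_subset_of_nonneg inter_subset_right fun l _ _ =>
      div_nonneg (demand_nonneg hf l) zero_le_two
  have h4 : ∑ k ∈ R, ∑ i ∈ I, f k (.ft i k) =
      2 * ∑ l ∈ R, (1 - ∑ i, g i l) / 2 - ∑ l ∈ R, sunk I f l := by
    rw [mul_sum, ← sum_sub_distrib]
    refine sum_congr rfl fun k _ => ?_
    rw [← hI]; ring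
  linarith

lemma exists_shift {j₀ l : D} (h : TransGen (fun k l => Exits I (f k) k l) j₀ l) :
    ∃ Δ τ i₀, Shift I f j₀ l Δ τ i₀ := by
  induction h with
  | single h => exact h.shift
  | tail _ he ih =>
    obtain ⟨Δ, τ, i₀, h⟩ := ih
    exact h.step he

/-- Small steps in a direction that keeps the flow balanced remain feasible. -/
lemma eventually_feasible (hf : IsFeasibleFlow U g x y f) (hC : CutData U g x y I J C)
    {Δ : D → MFNArc F D → ℝ} (hpos : ∀ k a, f k a = 0 → 0 ≤ Δ k a)
    (hnet : ∀ k v, v ≠ .sink k → netOutflow (Δ k) v = 0)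
    (htot : ∀ a, (∀ i j, a ≠ .ft i j) → ∑ k, Δ k a = 0)
    (hft : ∀ i ∉ I, ∀ j, ∑ k, Δ k (.ft i j) ≤ 0 ∨ f j (.ft i j) < mfnCap U g x y (.ft i j)) :
    ∀ᶠ ε in 𝓝[>] (0 : ℝ), IsFeasibleFlow U g x y (f + ε • Δ) := by
  have hcont : ∀ a b : ℝ, Tendsto (fun ε : ℝ => a + ε * b) (𝓝[>] 0) (𝓝 a) := fun a b => by
    have : Tendsto (fun ε : ℝ => a + ε * b) (𝓝 0) (𝓝 (a + 0 * b)) := by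
      apply Continuous.tendsto; fun_prop
    rw [zero_mul, add_zero] at this
    exact this.mono_left nhdsWithin_le_nhds
  have h1 : ∀ᶠ ε in 𝓝[>] (0 : ℝ), ∀ k a, 0 ≤ f k a + ε * Δ k a := by
    simp only [eventually_all]
    intro k a
    rcases (hf.1 k a).eq_or_lt with h0 | h0
    · filter_upwards [self_mem_nhdsWithin] with ε hε
      rw [← h0, zero_add]
      exact mul_nonneg (le_of_lt hε) (hpos k a h0.symm)
    · exact ((hcont _ _).eventually (lt_mem_nhds h0)).mono fun _ h => h.le
  have h2 : ∀ᶠ ε in 𝓝[>] (0 : ℝ), ∀ i j, i ∉ I →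
      f j (.ft i j) + ε * ∑ k, Δ k (.ft i j) ≤ mfnCap U g x y (.ft i j) := by
    simp only [eventually_all]
    intro i j hi
    rcases hft i hi j with h0 | h0
    · filter_upwards [self_mem_nhdsWithin] with ε hε
      have := mul_nonpos_of_nonneg_of_nonpos (le_of_lt hε) h0
      have := le_cap hf j (.ft i j)
      linarith
    · exact ((hcont _ _).eventually (gt_mem_nhds h0)).mono fun _ h => h.le
  filter_upwards [h1, h2] with ε h1 h2
  have hnet' : ∀ k v, v ≠ .sink k → netOutflow ((f + ε • Δ) k) v = netOutflow (f k) v := by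
    intro k v hv
    rw [Pi.add_apply, Pi.smul_apply, netOutflow_add, netOutflow_smul, hnet k v hv, mul_zero,
      add_zero]
  have hbal : ∀ k v, v ≠ MFNNode.src k → v ≠ .sink k → netOutflow ((f + ε • Δ) k) v = 0 :=
    fun k v hv hv' => by rw [hnet' k v hv', hf.2.1 k v hv hv']
  have hnn : ∀ k a, 0 ≤ (f + ε • Δ) k a := fun k a => h1 k a
  have hsrc : ∀ k, netOutflow ((f + ε • Δ) k) (.src k) = 1 - ∑ i, g i k :=
    fun k => by rw [hnet' k _ (by simp), hf.2.2.1 k]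
  refine ⟨hnn, hbal, hsrc, fun a => ?_⟩
  have hsum : ∑ k, (f + ε • Δ) k a = ∑ k, f k a + ε * ∑ k, Δ k a := by
    simp only [Pi.add_apply, Pi.smul_apply, smul_eq_mul, sum_add_distrib, mul_sum]
  by_cases ha : ∀ i j, a ≠ .ft i j
  · rw [hsum, htot a ha, mul_zero, add_zero]
    exact hf.2.2.2 a
  · push Not at ha
    obtain ⟨i, j, rfl⟩ := ha
    by_cases hi : i ∈ I
    · rw [Fintype.sum_eq_single j fun k hk => ft_eq_zero (hnn k) (hbal k) hk.symm i]
      refine (single_le_sum (f := fun i => (f + ε • Δ) j (.ft i j)) (fun i _ => hnn j _)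
        (mem_univ i)).trans ?_
      rw [sum_ft (hbal j), hsrc, mfnCap, hC.y_eq i hi, one_mul]
    · rw [hsum, sum_ft_commodity hf]
      exact h2 i j hi

/-- The total shortfall of the clients with respect to half of their demand. -/
noncomputable def shortfall (g : F → D → ℝ) (I : Finset F) (f : D → MFNArc F D → ℝ) : ℝ :=
  ∑ j, max 0 ((1 - ∑ i, g i j) / 2 - sunk I f j)

lemma exists_shortfall_lt (hf : IsFeasibleFlow U g x y f) (hC : CutData U g x y I J C) {j₀ : D}
    (hj₀ : sunk I f j₀ < (1 - ∑ i, g i j₀) / 2) :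
    ∃ f', IsFeasibleFlow U g x y f' ∧ shortfall g I f' < shortfall g I f := by
  obtain ⟨l, hl, hsur⟩ := exists_surplus hf hC hj₀
  have hlj : l ≠ j₀ := by rintro rfl; exact lt_asymm hj₀ hsur
  have hd₀ : 0 < 1 - ∑ i, g i j₀ := by
    have : 0 ≤ sunk I f j₀ := sum_nonneg fun i _ => hf.1 _ _
    linarith
  have hdl : 0 ≤ 1 - ∑ i, g i l := demand_nonneg hf l
  obtain ⟨s, hs, hlt⟩ : ∃ s ∈ Iᶜ,
      f j₀ (.ft s j₀) * (1 - ∑ i, g i l) < f l (.ft s l) * (1 - ∑ i, g i j₀) := by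
    apply exists_lt_of_sum_lt
    rw [← sum_mul, ← sum_mul]
    change sunk I f j₀ * _ < sunk I f l * _
    nlinarith
  rw [mem_compl] at hs
  have hsl : 0 < f l (.ft s l) := by
    have := mul_nonneg (hf.1 j₀ (.ft s j₀)) hdl
    exact pos_of_mul_pos_left (this.trans_lt hlt) hd₀.le
  have hslack : f j₀ (.ft s j₀) < mfnCap U g x y (.ft s j₀) := by
    have h1 : f l (.ft s l) ≤ y s * (1 - ∑ i, g i l) := le_cap hf l (.ft s l)
    change _ < y s * (1 - ∑ i, g i j₀)
    have hdl' : 0 < 1 - ∑ i, g i l := by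
      refine hdl.lt_of_ne fun h => ?_
      rw [← h, mul_zero] at h1
      linarith
    refine lt_of_mul_lt_mul_right (hlt.trans_le ?_) hdl
    calc _ ≤ y s * (1 - ∑ i, g i l) * (1 - ∑ i, g i j₀) := by gcongr
      _ = _ := by ring
  obtain ⟨Δ, τ, i₀, hΔ⟩ := exists_shift hl
  have hmid : 0 < f l (.mid s) := by rwa [mid_eq_ft (hf.1 l) (hf.2.1 l)]
  have hreach : ReflTransGen (FlowStep (f l)) (.src l) (.fac' s) :=
    reach_of_reach_sink (hf.1 l) (hf.2.1 l) (by simp) (ReflTransGen.single (flowStep hsl))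
  obtain ⟨Δ', hpos, hnet, htot, hft⟩ := hΔ.close hreach hsl
  have hev := eventually_feasible hf hC hpos hnet htot (fun i hi j => by
    by_cases h : i = s ∧ j = j₀
    · obtain ⟨rfl, rfl⟩ := h
      exact Or.inr hslack
    · refine Or.inl (sum_nonpos fun k _ => ?_)
      rw [hft i hi, if_neg (fun h' => h ⟨h'.1, h'.2.2⟩)]
      split_ifs <;> norm_num)
  have hsmall : ∀ᶠ ε in 𝓝[>] (0 : ℝ), ε < sunk I f l - (1 - ∑ i, g i l) / 2 :=
    nhdsWithin_le_nhds (gt_mem_nhds (by linarith))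
  obtain ⟨ε, hfε, hε, hε0⟩ := (hev.and (hsmall.and self_mem_nhdsWithin)).exists
  have hε0 : 0 < ε := hε0
  have hsunk : ∀ k, sunk I (f + ε • Δ') k =
      sunk I f k + ((if k = j₀ then ε else 0) - (if k = l then ε else 0)) := by
    intro k
    have : ∑ i ∈ Iᶜ, Δ' k (.ft i k) = (if k = j₀ then 1 else 0) - (if k = l then 1 else 0) := by
      rw [sum_congr rfl fun i hi => hft i (mem_compl.1 hi) k k]
      simp [sum_sub_distrib, ite_and, hs]
    simp only [sunk, Pi.add_apply, Pi.smul_apply, smul_eq_mul, sum_add_distrib, ← mul_sum, this]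
    split_ifs <;> ring
  refine ⟨_, hfε, sum_lt_sum (fun k _ => ?_) ⟨j₀, mem_univ _, ?_⟩⟩
  · rw [hsunk]
    by_cases hkl : k = l
    · subst hkl
      rw [if_neg hlj, if_pos rfl]
      exact max_le (le_max_left _ _) (le_max_of_le_left (by linarith))
    · rw [if_neg hkl]
      refine max_le_max le_rfl ?_
      split_ifs <;> linarith
  · rw [hsunk, if_pos rfl, if_neg hlj.symm,
      max_eq_right (a := 0) (b := _ - sunk I f j₀) (by linarith)]
    exact max_lt (by linarith) (by linarith)

lemma continuous_netOutflow (k : D) (v : MFNNode F D) :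
    Continuous fun f : D → MFNArc F D → ℝ => netOutflow (f k) v := by
  simp only [netOutflow_eq]
  fun_prop

lemma isCompact_feasible : IsCompact {f | IsFeasibleFlow U g x y f} := by
  refine (isCompact_univ_pi (s := fun _ : D => Set.univ.pi fun a => Set.Icc 0 (mfnCap U g x y a))
    fun _ => isCompact_univ_pi fun _ => isCompact_Icc).of_isClosed_subset ?_ ?_
  · simp only [IsFeasibleFlow, Set.ofPred_and, Set.ofPred_forall]
    refine .inter ?_ (.inter ?_ (.inter ?_ ?_))
    · exact isClosed_iInter fun k => isClosed_iInter fun a =>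
        isClosed_le continuous_const (by fun_prop)
    · exact isClosed_iInter fun k => isClosed_iInter fun v => isClosed_iInter fun _ =>
        isClosed_iInter fun _ => isClosed_eq (continuous_netOutflow k v) continuous_const
    · exact isClosed_iInter fun k => isClosed_eq (continuous_netOutflow k _) continuous_const
    · exact isClosed_iInter fun a => isClosed_le (by fun_prop) continuous_const
  · exact fun f hf k _ a _ => ⟨hf.1 k a, le_cap hf k a⟩

lemma exists_half_sunk (hfeas : MFNFeasible U g x y) (hC : CutData U g x y I J C) :
    ∃ f, IsFeasibleFlow U g x y f ∧ ∀ j, (1 - ∑ i, g i j) / 2 ≤ sunk I f j := by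
  obtain ⟨f, hf, hmin⟩ := isCompact_feasible.exists_isMinOn (f := shortfall g I) hfeas (by
    unfold shortfall sunk
    fun_prop)
  refine ⟨f, hf, fun j => ?_⟩
  by_contra! hj
  obtain ⟨f', hf', hlt⟩ := exists_shortfall_lt hf hC hj
  exact absurd (hmin hf') (not_le.2 hlt)

end Feasible

section Matching

variable {U : F → ℕ} {I : Finset F} {z x : F → D → ℝ}

lemma mem_of_inIH {i : F} (h : InIH I z x i) : i ∈ I := by
  obtain ⟨k, _, h⟩ := h
  rcases ReflTransGen.cases_tail h with h | ⟨c, _, h⟩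
  · cases h
  · rcases c with c | c
    · exact h.elim
    · exact h.1

/-- An alternating walk in `H` yields a direction in which the matching can be changed. -/
lemma exists_alternating {k : D} {v : F ⊕ D}
    (h : ReflTransGen (HStep I z x) (Sum.inr k) v) :
    ∃ δ : F → D → ℝ, (∀ i ∉ I, ∀ j, δ i j = 0) ∧ (∀ i j, z i j = 0 → 0 ≤ δ i j) ∧
      (∀ i j, z i j = 2 * x i j → δ i j ≤ 0) ∧
      (∀ j, ∑ i ∈ I, δ i j = (if j = k then 1 else 0) - (if v = Sum.inr j then 1 else 0)) ∧
      (∀ i, ∑ j, δ i j = if v = Sum.inl i then 1 else 0) := by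
  induction h with
  | refl => exact ⟨0, by simp, by simp, by simp, by simp [eq_comm], by simp⟩
  | @tail b c _ hs ih =>
    obtain ⟨δ, h1, h2, h3, h4, h5⟩ := ih
    rcases b with i | j <;> rcases c with i' | j'
    · exact hs.elim
    · obtain ⟨hi, hz⟩ : i ∈ I ∧ 0 < z i j' := hs
      refine ⟨fun a b => δ a b - if a = i ∧ b = j' then 1 else 0, ?_, ?_, ?_, ?_, ?_⟩
      · intro a ha b
        have : a ≠ i := by rintro rfl; exact ha hi
        simp [h1 a ha, this]
      · intro a b hab
        have : ¬(a = i ∧ b = j') := by rintro ⟨rfl, rfl⟩; exact hz.ne' hab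
        simp [this, h2 a b hab]
      · intro a b hab
        have := h3 a b hab
        dsimp only
        split_ifs <;> linarith
      · intro b
        rw [sum_sub_distrib, h4]
        simp [ite_and, hi, eq_comm (a := b) (b := j')]
      · intro a
        rw [sum_sub_distrib, h5]
        simp [ite_and, eq_comm (a := a) (b := i)]
    · obtain ⟨hi, hz⟩ : i' ∈ I ∧ z i' j < 2 * x i' j := hs
      refine ⟨fun a b => δ a b + if a = i' ∧ b = j then 1 else 0, ?_, ?_, ?_, ?_, ?_⟩
      · intro a ha b
        have : a ≠ i' := by rintro rfl; exact ha hi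
        simp [h1 a ha, this]
      · intro a b hab
        have := h2 a b hab
        dsimp only
        split_ifs <;> linarith
      · intro a b hab
        have : ¬(a = i' ∧ b = j) := by rintro ⟨rfl, rfl⟩; exact hz.ne hab
        simp [this, h3 a b hab]
      · intro b
        rw [sum_add_distrib, h4]
        simp [ite_and, hi, eq_comm (a := b) (b := j)]
      · intro a
        rw [sum_add_distrib, h5]
        simp [ite_and, eq_comm (a := a) (b := i')]
    · exact hs.elim

/-- A maximum `b`-matching uses the whole capacity of every facility in `I_H`. -/
lemma sum_eq_capacity_of_inIH
    (hz0 : ∀ i j, 0 ≤ z i j)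
    (hzx : ∀ i ∈ I, ∀ j, z i j ≤ 2 * x i j)
    (hz1 : ∀ j, ∑ i ∈ I, z i j ≤ 1)
    (hzU : ∀ i ∈ I, ∑ j, z i j ≤ (U i : ℝ))
    (hzmax : ∀ z' : F → D → ℝ, (∀ i j, 0 ≤ z' i j) →
      (∀ i ∈ I, ∀ j, z' i j ≤ 2 * x i j) →
      (∀ j, ∑ i ∈ I, z' i j ≤ 1) → (∀ i ∈ I, ∑ j, z' i j ≤ (U i : ℝ)) →
      ∑ i ∈ I, ∑ j, z' i j ≤ ∑ i ∈ I, ∑ j, z i j)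
    {i₀ : F} (hi₀ : InIH I z x i₀) : ∑ j, z i₀ j = U i₀ := by
  have hmem := mem_of_inIH hi₀
  obtain ⟨k, hk, hwalk⟩ := hi₀
  by_contra hne
  have hltU : ∑ j, z i₀ j < U i₀ := (hzU i₀ hmem).lt_of_ne hne
  have hlt1 : ∑ i ∈ I, z i k < 1 := (hz1 k).lt_of_ne hk
  obtain ⟨δ, h1, h2, h3, h4, h5⟩ := exists_alternating hwalk
  have hcont : ∀ a b : ℝ, Tendsto (fun ε : ℝ => a + ε * b) (𝓝[>] 0) (𝓝 a) := fun a b => by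
    have : Tendsto (fun ε : ℝ => a + ε * b) (𝓝 0) (𝓝 (a + 0 * b)) := by
      apply Continuous.tendsto; fun_prop
    rw [zero_mul, add_zero] at this
    exact this.mono_left nhdsWithin_le_nhds
  have e1 : ∀ᶠ ε in 𝓝[>] (0 : ℝ), ∀ i j, 0 ≤ z i j + ε * δ i j := by
    simp only [eventually_all]
    intro i j
    rcases (hz0 i j).eq_or_lt with h0 | h0
    · filter_upwards [self_mem_nhdsWithin] with ε hε
      rw [← h0, zero_add]
      exact mul_nonneg (le_of_lt hε) (h2 i j h0.symm)
    · exact ((hcont _ _).eventually (lt_mem_nhds h0)).mono fun _ h => h.le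
  have e2 : ∀ᶠ ε in 𝓝[>] (0 : ℝ), ∀ i j, i ∈ I → z i j + ε * δ i j ≤ 2 * x i j := by
    simp only [eventually_all]
    intro i j hi
    rcases (hzx i hi j).eq_or_lt with h0 | h0
    · filter_upwards [self_mem_nhdsWithin] with ε hε
      have := mul_nonpos_of_nonneg_of_nonpos (le_of_lt hε) (h3 i j h0)
      linarith
    · exact ((hcont _ _).eventually (gt_mem_nhds h0)).mono fun _ h => h.le
  have e3 : ∀ᶠ ε in 𝓝[>] (0 : ℝ), ∑ i ∈ I, z i k + ε * 1 < 1 :=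
    (hcont _ _).eventually (gt_mem_nhds hlt1)
  have e4 : ∀ᶠ ε in 𝓝[>] (0 : ℝ), ∑ j, z i₀ j + ε * 1 < U i₀ :=
    (hcont _ _).eventually (gt_mem_nhds hltU)
  obtain ⟨ε, h6, h7, h8, h9, hε⟩ :=
    (e1.and (e2.and (e3.and (e4.and self_mem_nhdsWithin)))).exists
  have hε : 0 < ε := hε
  have hmax := hzmax (fun i j => z i j + ε * δ i j) h6 (fun i hi j => h7 i j hi) ?_ ?_
  · simp only [sum_add_distrib, ← mul_sum, h5] at hmax
    simp [hmem] at hmax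
    linarith
  · intro j
    rw [sum_add_distrib, ← mul_sum, h4]
    by_cases hj : j = k
    · subst hj; simpa using h8.le
    · simpa [hj] using hz1 j
  · intro i hi
    rw [sum_add_distrib, ← mul_sum, h5]
    by_cases hii : i = i₀
    · subst hii; simpa using h9.le
    · simpa [Ne.symm hii] using hzU i hi

lemma inDH_of_unsat {j : D} (h : Unsat I z j) : InDH I z x j := ⟨j, h, ReflTransGen.refl⟩

lemma inIH_of_inDH {i : F} {j : D} (hj : InDH I z x j) (hi : i ∈ I) (h : z i j < 2 * x i j) :
    InIH I z x i := by
  obtain ⟨k, hk, hw⟩ := hj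
  exact ⟨k, hk, hw.tail (show HStep I z x (Sum.inr j) (Sum.inl i) from ⟨hi, h⟩)⟩

lemma inDH_of_inIH {i : F} {j : D} (hi : InIH I z x i) (h : 0 < z i j) : InDH I z x j := by
  have hmem := mem_of_inIH hi
  obtain ⟨k, hk, hw⟩ := hi
  exact ⟨k, hk, hw.tail (show HStep I z x (Sum.inl i) (Sum.inr j) from ⟨hmem, h⟩)⟩

/-- The partial assignment obtained from a maximum `b`-matching satisfies the cut properties. -/
lemma cutData_of_matching {y : F → ℝ} {g : F → D → ℝ} (hy : ∀ i ∈ I, y i = 1)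
    (hz0 : ∀ i j, 0 ≤ z i j)
    (hzx : ∀ i ∈ I, ∀ j, z i j ≤ 2 * x i j)
    (hzoff : ∀ i ∉ I, ∀ j, z i j = 0)
    (hz1 : ∀ j, ∑ i ∈ I, z i j ≤ 1)
    (hsat : ∀ i, InIH I z x i → ∑ j, z i j = U i)
    (hg : ∀ i j, g i j =
      if InIH I z x i then z i j
      else if i ∈ I ∧ ¬ InDH I z x j then z i j else 0) :
    CutData U g x y I (univ.filter (InIH I z x)) (univ.filter (InDH I z x)) where
  mid i hi := by
    have hi : InIH I z x i := by simpa using hi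
    simp only [hg, if_pos hi, hsat i hi, sub_self, mul_zero]
  gs i j hj hij := by
    have hj : ¬ InDH I z x j := by simpa using hj
    simp only [Finset.mem_sdiff, Finset.mem_filter, Finset.mem_univ, true_and]
    rw [hg] at hij
    split_ifs at hij with h1 h2
    · exact absurd (inDH_of_inIH h1 ((hz0 i j).lt_of_ne hij.symm)) hj
    · exact ⟨h2.1, h1⟩
    · exact absurd rfl hij
  sx j hj := by
    have hj : InDH I z x j := by simpa using hj
    have hxz : ∀ i ∈ I \ univ.filter (InIH I z x), x i j = z i j / 2 := by
      intro i hi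
      simp only [Finset.mem_sdiff, Finset.mem_filter, Finset.mem_univ, true_and] at hi
      have h1 : ¬ z i j < 2 * x i j := fun h => hi.2 (inIH_of_inDH hj hi.1 h)
      have h2 := hzx i hi.1 j
      linarith
    have hsub : univ.filter (InIH I z x) ⊆ I := fun i hi => mem_of_inIH (by simpa using hi)
    have hsum : ∑ i, g i j = ∑ i ∈ univ.filter (InIH I z x), z i j := by
      rw [sum_filter]
      exact sum_congr rfl fun i _ => by simp [hg, hj]
    rw [sum_congr rfl hxz, ← sum_div, hsum]
    have := hz1 j
    rw [← sum_sdiff hsub] at this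
    linarith
  demand j hj := by
    have hj : ¬ InDH I z x j := by simpa using hj
    have h1 : ∑ i ∈ I, z i j = 1 := by
      by_contra h
      exact hj (inDH_of_unsat h)
    have h2 : ∑ i, g i j = ∑ i ∈ I, z i j := by
      rw [← sum_subset (subset_univ I) fun i _ hi => ?_]
      · exact sum_congr rfl fun i hi => by simp [hg, hi, hj]
      · simp [hg, hi, hzoff i hi]
    rw [h2, h1, sub_self]
  y_eq := hy

end Matching

end MFN

/-- If `MFN(g*, x*, y')` is feasible, then there is a feasible flow in
which every client sinks at least half of its demand at facilities in `S = F \ I`. -/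
theorem stmt_12
    (U : F → ℕ) (hU : ∀ i, 0 < U i)
    (xstar : F → D → ℝ) (ystar : F → ℝ)
    (hxs : ∀ i j, 0 ≤ xstar i j ∧ xstar i j ≤ 1)
    (hys : ∀ i, 0 ≤ ystar i ∧ ystar i ≤ 1)
    (y' : F → ℝ) (hy' : ∀ i, y' i = if (1 / 4 : ℝ) ≤ ystar i then 1 else ystar i)
    (I : Finset F) (hI : ∀ i, i ∈ I ↔ y' i = 1)
    (z : F → D → ℝ)
    (hz0 : ∀ i j, 0 ≤ z i j)
    (hzx : ∀ i ∈ I, ∀ j, z i j ≤ 2 * xstar i j)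
    (hzoff : ∀ i ∉ I, ∀ j, z i j = 0)
    (hz1 : ∀ j, ∑ i ∈ I, z i j ≤ 1)
    (hzU : ∀ i ∈ I, ∑ j, z i j ≤ (U i : ℝ))
    (hzmax : ∀ z' : F → D → ℝ, (∀ i j, 0 ≤ z' i j) →
      (∀ i ∈ I, ∀ j, z' i j ≤ 2 * xstar i j) →
      (∀ j, ∑ i ∈ I, z' i j ≤ 1) → (∀ i ∈ I, ∑ j, z' i j ≤ (U i : ℝ)) →
      ∑ i ∈ I, ∑ j, z' i j ≤ ∑ i ∈ I, ∑ j, z i j)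
    (gstar : F → D → ℝ)
    (hgstar : ∀ i j, gstar i j =
      if InIH I z xstar i then z i j
      else if i ∈ I ∧ ¬ InDH I z xstar j then z i j else 0)
    (hfeas : MFNFeasible U gstar xstar y') :
    ∃ f : D → MFNArc F D → ℝ, IsFeasibleFlow U gstar xstar y' f ∧
      ∀ j : D, (1 - ∑ i, gstar i j) / 2 ≤
        ∑ i ∈ Finset.univ.filter (fun i => i ∉ I), f j (MFNArc.mid i) := by
  have hC := MFN.cutData_of_matching (fun i hi => (hI i).1 hi) hz0 hzx hzoff hz1
    (fun i hi => MFN.sum_eq_capacity_of_inIH hz0 hzx hz1 hzU hzmax hi) hgstar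
  obtain ⟨f, hf, hhalf⟩ := MFN.exists_half_sunk hfeas hC
  refine ⟨f, hf, fun j => (hhalf j).trans_eq ?_⟩
  have hcompl : Iᶜ = Finset.univ.filter (fun i => i ∉ I) := by ext; simp
  rw [MFN.sunk, hcompl]
  exact Finset.sum_congr rfl fun i _ => (MFN.mid_eq_ft (hf.1 j) (hf.2.1 j) i).symm
end

section
/- If (x*,y*) is feasible for MFNLP, then there exists a semi-integral pair (x̂,ŷ) with c(x̂,ŷ) ≤ 8·c(x*,y*). -/
/-!
Formalization of statements from "An LP-rounding approach to capacitated facility location".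

`F` is the (finite) type of facilities, `D` the type of clients, `U i` the (positive integer)
capacity of facility `i`.  The multi-commodity flow network `MFN(g, x, y)` has nodes
`j^s, j^t` for clients `j` and `i, i'` for facilities `i`; its arcs and capacities are as in
`MFNArc` / `mfnCap` below.
-/

open scoped BigOperators Classical

variable {F D : Type}

variable [Fintype F] [Fintype D]

/-- The cost of a (fractional) solution `(x, y)`: total opening cost plus total
connection cost. -/
noncomputable def cflCost (o : F → ℝ) (c : F → D → ℝ) (x : F → D → ℝ) (y : F → ℝ) : ℝ :=
  ∑ i, o i * y i + ∑ i, ∑ j, c i j * x i j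

/-- `(x, y)` is a semi-integral solution: the assignment constraints hold, every opening
variable is either `1` or at most `1/2`, and (with `S = {i : y i ≠ 1}` and
`d̂ j = ∑ i ∈ S, x i j`) one has `x i j ≤ y i * d̂ j` for every `i ∈ S`. -/
def SemiIntegral (U : F → ℕ) (x : F → D → ℝ) (y : F → ℝ) : Prop :=
  (∀ i j, 0 ≤ x i j ∧ x i j ≤ 1) ∧ (∀ i, 0 ≤ y i ∧ y i ≤ 1) ∧
  (∀ j, ∑ i, x i j = 1) ∧
  (∀ i, ∑ j, x i j ≤ y i * (U i : ℝ)) ∧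
  (∀ i, y i = 1 ∨ y i ≤ 1 / 2) ∧
  (∀ i, y i ≠ 1 → ∀ j,
    x i j ≤ y i * ∑ i' ∈ Finset.univ.filter (fun i' => y i' ≠ 1), x i' j)

/-- A capacitated assignment minimizing the sum of squared unmet demands, together with the
optimality condition for changing a single row `i` by a vector `q`. -/
lemma exists_capped_assignment_min_sq (V : F → ℝ) (hV : ∀ i, 0 ≤ V i) (u : F → D → ℝ)
    (hu : ∀ i j, 0 ≤ u i j) :
    ∃ g : F → D → ℝ, (∀ i j, 0 ≤ g i j) ∧ (∀ i j, g i j ≤ u i j) ∧ (∀ j, ∑ i, g i j ≤ 1) ∧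
      (∀ i, ∑ j, g i j ≤ V i) ∧
      ∀ (i : F) (q : D → ℝ), (∀ j, 0 ≤ g i j + q j) → (∀ j, g i j + q j ≤ u i j) →
        (∀ j, q j ≤ 1 - ∑ i', g i' j) → ∑ j, g i j + ∑ j, q j ≤ V i →
        2 * ∑ j, (1 - ∑ i', g i' j) * q j ≤ ∑ j, q j ^ 2 := by
  have hcol (j : D) : Continuous fun g : F → D → ℝ => ∑ i, g i j := by fun_prop
  have hrow (i : F) : Continuous fun g : F → D → ℝ => ∑ j, g i j := by fun_prop
  have hcomp : IsCompact (Set.Icc (0 : F → D → ℝ) u ∩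
      ({g | ∀ j, ∑ i, g i j ≤ 1} ∩ {g | ∀ i, ∑ j, g i j ≤ V i})) := by
    refine isCompact_Icc.inter_right (IsClosed.inter ?_ ?_)
    · simp only [Set.ofPred_forall]
      exact isClosed_iInter fun j => isClosed_le (hcol j) continuous_const
    · simp only [Set.ofPred_forall]
      exact isClosed_iInter fun i => isClosed_le (hrow i) continuous_const
  obtain ⟨g, ⟨⟨hg0, hgu⟩, hg1, hgV⟩, hmin⟩ := hcomp.exists_isMinOn
    ⟨0, ⟨le_rfl, hu⟩, fun j => by simp, fun i => by simpa using hV i⟩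
    (f := fun g => ∑ j, (1 - ∑ i, g i j) ^ 2) (by fun_prop)
  refine ⟨g, hg0, hgu, hg1, hgV, fun i q hq0 hqu hq1 hqV => ?_⟩
  let h : F → D → ℝ := fun i' j => g i' j + if i' = i then q j else 0
  have hcolh (j : D) : ∑ i', h i' j = ∑ i', g i' j + q j := by
    simp [h, Finset.sum_add_distrib]
  have hmem : h ∈ Set.Icc (0 : F → D → ℝ) u ∩
      ({g | ∀ j, ∑ i, g i j ≤ 1} ∩ {g | ∀ i, ∑ j, g i j ≤ V i}) := by
    refine ⟨⟨fun i' j => ?_, fun i' j => ?_⟩, fun j => ?_, fun i' => ?_⟩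
    · by_cases e : i' = i
      · subst e; simpa [h] using hq0 j
      · simpa [h, e] using hg0 i' j
    · by_cases e : i' = i
      · subst e; simpa [h] using hqu j
      · simpa [h, e] using hgu i' j
    · rw [hcolh]; linarith [hq1 j]
    · by_cases e : i' = i
      · subst e; simpa [h, Finset.sum_add_distrib] using hqV
      · simpa [h, e] using hgV i'
  have hle := hmin hmem
  simp only [Set.mem_ofPred_eq, hcolh] at hle
  have hexp : ∑ j, (1 - (∑ i', g i' j + q j)) ^ 2 =
      ∑ j, (1 - ∑ i', g i' j) ^ 2 - 2 * ∑ j, (1 - ∑ i', g i' j) * q j + ∑ j, q j ^ 2 := by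
    rw [Finset.mul_sum, ← Finset.sum_sub_distrib, ← Finset.sum_add_distrib]
    exact Finset.sum_congr rfl fun j _ => by ring
  linarith

/-- A maximal capacitated assignment: a facility with residual edge capacity to some client that is
not fully assigned is saturated, and serves no fully assigned client. -/
lemma exists_maximal_capped_assignment (V : F → ℝ) (hV : ∀ i, 0 ≤ V i) (u : F → D → ℝ)
    (hu : ∀ i j, 0 ≤ u i j) :
    ∃ g : F → D → ℝ, (∀ i j, 0 ≤ g i j) ∧ (∀ i j, g i j ≤ u i j) ∧ (∀ j, ∑ i, g i j ≤ 1) ∧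
      (∀ i, ∑ j, g i j ≤ V i) ∧
      ∀ i j, ∑ i', g i' j < 1 → g i j < u i j →
        ∑ j', g i j' = V i ∧ ∀ j', ∑ i', g i' j' = 1 → g i j' = 0 := by
  obtain ⟨g, hg0, hgu, hg1, hgV, hopt⟩ := exists_capped_assignment_min_sq V hV u hu
  refine ⟨g, hg0, hgu, hg1, hgV, fun i j hj hij => ⟨?_, fun j' hj' => ?_⟩⟩
  · by_contra hne
    have hlt := lt_of_le_of_ne (hgV i) hne
    obtain ⟨ε, hε, hε'⟩ := exists_between (lt_min (sub_pos.2 hj)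
      (lt_min (sub_pos.2 hij) (sub_pos.2 hlt)))
    simp only [lt_min_iff] at hε'
    obtain ⟨h1, h2, h3⟩ := hε'
    have := hopt i (Pi.single j ε) (fun k => ?_) (fun k => ?_) (fun k => ?_) ?_
    · simp [Pi.single_apply] at this
      nlinarith
    · rcases eq_or_ne k j with rfl | e
      · simp; linarith [hg0 i k]
      · simpa [e] using hg0 i k
    · rcases eq_or_ne k j with rfl | e
      · simp; linarith
      · simpa [e] using hgu i k
    · rcases eq_or_ne k j with rfl | e
      · simp; linarith
      · simpa [e] using hg1 k
    · simp; linarith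
  · by_contra hne
    have hpos := lt_of_le_of_ne (hg0 i j') (Ne.symm hne)
    have hjj : j ≠ j' := by rintro rfl; linarith
    obtain ⟨ε, hε, hε'⟩ := exists_between (lt_min (sub_pos.2 hj)
      (lt_min (sub_pos.2 hij) hpos))
    simp only [lt_min_iff] at hε'
    obtain ⟨h1, h2, h3⟩ := hε'
    have := hopt i (Pi.single j ε - Pi.single j' ε) (fun k => ?_) (fun k => ?_) (fun k => ?_) ?_
    · have hsq : ∑ k, (Pi.single j ε - Pi.single j' ε : D → ℝ) k ^ 2 = ε ^ 2 + ε ^ 2 := by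
        have : ∀ k, (Pi.single j ε - Pi.single j' ε : D → ℝ) k ^ 2 =
            (Pi.single j (ε ^ 2) : D → ℝ) k + (Pi.single j' (ε ^ 2) : D → ℝ) k := by
          intro k
          rcases eq_or_ne k j with rfl | e
          · simp [hjj]
          · rcases eq_or_ne k j' with rfl | e'
            · simp [e]
            · simp [e, e']
        rw [Finset.sum_congr rfl fun k _ => this k, Finset.sum_add_distrib]
        simp
      have hlin : ∑ k, (1 - ∑ i', g i' k) * (Pi.single j ε - Pi.single j' ε : D → ℝ) k =
          (1 - ∑ i', g i' j) * ε := by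
        simp [mul_sub, Finset.sum_sub_distrib, Pi.single_apply, hj']
      rw [hsq, hlin] at this
      nlinarith
    · rcases eq_or_ne k j with rfl | e
      · simp [hjj]; linarith [hg0 i k]
      · rcases eq_or_ne k j' with rfl | e'
        · simp [e]; linarith
        · simpa [e, e'] using hg0 i k
    · rcases eq_or_ne k j with rfl | e
      · simp [hjj]; linarith
      · rcases eq_or_ne k j' with rfl | e'
        · simp [e]; linarith [hgu i k]
        · simpa [e, e'] using hgu i k
    · rcases eq_or_ne k j with rfl | e
      · simp [hjj]; linarith
      · rcases eq_or_ne k j' with rfl | e'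
        · simp [e]; linarith
        · simpa [e, e'] using hg1 k
    · simp [Finset.sum_sub_distrib]; linarith [hgV i]

lemma MFNArc.sum_eq (h : MFNArc F D → ℝ) :
    ∑ a, h a = ∑ i, h (.mid i) + ∑ j, ∑ i, h (.sx j i) + ∑ i, ∑ j, h (.gs i j) +
      ∑ i, ∑ j, h (.ft i j) := by
  let e : F ⊕ (D × F) ⊕ (F × D) ⊕ (F × D) ≃ MFNArc F D :=
    { toFun := Sum.elim .mid (Sum.elim (fun p => .sx p.1 p.2)
        (Sum.elim (fun p => .gs p.1 p.2) (fun p => .ft p.1 p.2)))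
      invFun := fun
        | .mid i => .inl i
        | .sx j i => .inr (.inl (j, i))
        | .gs i j => .inr (.inr (.inl (i, j)))
        | .ft i j => .inr (.inr (.inr (i, j)))
      left_inv := by rintro (_ | _ | _ | _) <;> rfl
      right_inv := by rintro (_ | _ | _ | _) <;> rfl }
  rw [← e.sum_comp]
  simp [e, Fintype.sum_sum_type, Fintype.sum_prod_type, add_assoc]

lemma netOutflow_src (f : MFNArc F D → ℝ) (j : D) :
    netOutflow f (.src j) = ∑ i, f (.sx j i) - ∑ i, f (.gs i j) := by
  simp only [netOutflow, Finset.sum_filter, MFNArc.sum_eq]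
  simp [MFNArc.tail, MFNArc.head, Finset.sum_ite_irrel]

lemma netOutflow_fac (f : MFNArc F D → ℝ) (i : F) :
    netOutflow f (.fac i) = f (.mid i) + ∑ j, f (.gs i j) - ∑ j, f (.sx j i) := by
  simp only [netOutflow, Finset.sum_filter, MFNArc.sum_eq]
  simp [MFNArc.tail, MFNArc.head, Finset.sum_ite_irrel]

lemma netOutflow_fac' (f : MFNArc F D → ℝ) (i : F) :
    netOutflow f (.fac' i) = ∑ j, f (.ft i j) - f (.mid i) := by
  simp only [netOutflow, Finset.sum_filter, MFNArc.sum_eq]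
  simp [MFNArc.tail, MFNArc.head, Finset.sum_ite_irrel]

lemma netOutflow_sink (f : MFNArc F D → ℝ) (j : D) :
    netOutflow f (.sink j) = - ∑ i, f (.ft i j) := by
  simp only [netOutflow, Finset.sum_filter, MFNArc.sum_eq]
  simp [MFNArc.tail, MFNArc.head]

namespace IsFeasibleFlow

variable {U : F → ℕ} {g x : F → D → ℝ} {y : F → ℝ} {f : D → MFNArc F D → ℝ}

lemma mid_add_sum_gs (hf : IsFeasibleFlow U g x y f) (j : D) (i : F) :
    f j (.mid i) + ∑ v, f j (.gs i v) = ∑ v, f j (.sx v i) := by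
  have := hf.2.1 j (.fac i) (by simp) (by simp)
  rw [netOutflow_fac] at this
  linarith

lemma sum_sx_eq (hf : IsFeasibleFlow U g x y f) {j v : D} (h : v ≠ j) :
    ∑ i, f j (.sx v i) = ∑ i, f j (.gs i v) := by
  have := hf.2.1 j (.src v) (by simpa using h) (by simp)
  rw [netOutflow_src] at this
  linarith

lemma sum_sx_self (hf : IsFeasibleFlow U g x y f) (j : D) :
    ∑ i, f j (.sx j i) = ∑ i, f j (.gs i j) + (1 - ∑ i, g i j) := by
  have := hf.2.2.1 j
  rw [netOutflow_src] at this
  linarith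

lemma le_cap (hf : IsFeasibleFlow U g x y f) (j : D) (a : MFNArc F D) :
    f j a ≤ mfnCap U g x y a :=
  (Finset.single_le_sum (f := fun j => f j a) (fun j _ => hf.1 j a) (Finset.mem_univ j)).trans
    (hf.2.2.2 a)

lemma ft_eq_zero (hf : IsFeasibleFlow U g x y f) {j v : D} (h : v ≠ j) (i : F) :
    f j (.ft i v) = 0 := by
  have := hf.2.1 j (.sink v) (by simp) (by simpa using h)
  rw [netOutflow_sink, neg_eq_zero,
    Finset.sum_eq_zero_iff_of_nonneg fun i _ => hf.1 j _] at this
  exact this i (Finset.mem_univ i)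

lemma mid_le (hf : IsFeasibleFlow U g x y f) (j : D) (i : F) :
    f j (.mid i) ≤ y i * (1 - ∑ i', g i' j) := by
  have h := hf.2.1 j (.fac' i) (by simp) (by simp)
  rw [netOutflow_fac', Finset.sum_eq_single_of_mem j (Finset.mem_univ j)
    fun v _ hv => hf.ft_eq_zero hv i] at h
  have := hf.le_cap j (.ft i j)
  simp only [mfnCap] at this
  linarith

/-- Weighting the conservation laws by a potential `π` on facilities and `ρ` on clients. -/
lemma sum_potential (hf : IsFeasibleFlow U g x y f) (j : D) (π : F → ℝ) (ρ : D → ℝ) :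
    ∑ i, π i * f j (.mid i) = ρ j * (1 - ∑ i, g i j) +
      ∑ i, ∑ v, ((π i - ρ v) * f j (.sx v i) + (ρ v - π i) * f j (.gs i v)) := by
  have h1 : ∑ i, π i * f j (.mid i) =
      ∑ i, ∑ v, (π i * f j (.sx v i) - π i * f j (.gs i v)) := by
    refine Finset.sum_congr rfl fun i _ => ?_
    rw [Finset.sum_sub_distrib, ← Finset.mul_sum, ← Finset.mul_sum, ← hf.mid_add_sum_gs]
    ring
  have h2 : ∑ i, ∑ v, (ρ v * f j (.sx v i) - ρ v * f j (.gs i v)) =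
      ρ j * (1 - ∑ i, g i j) := by
    rw [Finset.sum_comm, Finset.sum_eq_single_of_mem j (Finset.mem_univ j)]
    · rw [Finset.sum_sub_distrib, ← Finset.mul_sum, ← Finset.mul_sum, hf.sum_sx_self]
      ring
    · intro v _ hv
      rw [Finset.sum_sub_distrib, ← Finset.mul_sum, ← Finset.mul_sum, hf.sum_sx_eq hv, sub_self]
  rw [h1, ← h2, ← Finset.sum_add_distrib]
  refine Finset.sum_congr rfl fun i _ => ?_
  rw [← Finset.sum_add_distrib]
  exact Finset.sum_congr rfl fun v _ => by ring

lemma sum_mid (hf : IsFeasibleFlow U g x y f) (j : D) :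
    ∑ i, f j (.mid i) = 1 - ∑ i, g i j := by
  simpa using hf.sum_potential j 1 1

/-- Sending each commodity directly to the facilities where it ends costs at most as much as the
arcs available to the flow. -/
lemma sum_cost_mid_le (hf : IsFeasibleFlow U g x y f) {dmet : F ⊕ D → F ⊕ D → ℝ}
    (hd0 : ∀ u, dmet u u = 0) (hdsym : ∀ u v, dmet u v = dmet v u)
    (hdtri : ∀ u v w, dmet u w ≤ dmet u v + dmet v w) :
    ∑ i, ∑ j, dmet (.inl i) (.inr j) * f j (.mid i) ≤
      ∑ i, ∑ j, dmet (.inl i) (.inr j) * (x i j + g i j) := by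
  have hd : ∀ u v, 0 ≤ dmet u v := fun u v => by
    have := hdtri u v u
    rw [hd0, hdsym v u] at this
    linarith
  have hj : ∀ j, ∑ i, dmet (.inl i) (.inr j) * f j (.mid i) ≤
      ∑ i, ∑ v, dmet (.inl i) (.inr v) * (f j (.sx v i) + f j (.gs i v)) := by
    intro j
    rw [hf.sum_potential j _ fun v => dmet (.inr v) (.inr j), hd0, zero_mul, zero_add]
    refine Finset.sum_le_sum fun i _ => Finset.sum_le_sum fun v _ => ?_
    have h1 := hdtri (.inl i) (.inr v) (.inr j)
    have h2 := hdtri (.inr v) (.inl i) (.inr j)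
    rw [hdsym (.inr v) (.inl i)] at h2
    rw [mul_add]
    exact add_le_add (mul_le_mul_of_nonneg_right (by linarith) (hf.1 _ _))
      (mul_le_mul_of_nonneg_right (by linarith) (hf.1 _ _))
  rw [Finset.sum_comm]
  refine (Finset.sum_le_sum fun j _ => hj j).trans ?_
  rw [Finset.sum_comm]
  refine Finset.sum_le_sum fun i _ => ?_
  rw [Finset.sum_comm]
  refine Finset.sum_le_sum fun v _ => ?_
  rw [← Finset.mul_sum, Finset.sum_add_distrib]
  exact mul_le_mul_of_nonneg_left
    (add_le_add (hf.2.2.2 (.sx v i)) (hf.2.2.2 (.gs i v))) (hd _ _)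

lemma sx_eq_zero (hf : IsFeasibleFlow U g x y f) {j v : D} (h : v ≠ j)
    (hg : ∀ i, g i v = 0) (i : F) : f j (.sx v i) = 0 := by
  have h0 : ∑ i, f j (.sx v i) = 0 := by
    rw [hf.sum_sx_eq h]
    refine Finset.sum_eq_zero fun i _ => le_antisymm ?_ (hf.1 _ _)
    simpa [mfnCap, hg] using hf.le_cap j (.gs i v)
  rw [Finset.sum_eq_zero_iff_of_nonneg fun i _ => hf.1 j _] at h0
  exact h0 i (Finset.mem_univ i)

/-- If clients outside `R` have no assignment, the commodities in `R` can enter an unused facility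
only from clients in `R`. -/
lemma sum_mid_le_sum (hf : IsFeasibleFlow U g x y f) (R : Finset D)
    (hR : ∀ v ∉ R, ∀ i, g i v = 0) (i : F) :
    ∑ j ∈ R, f j (.mid i) ≤ ∑ v ∈ R, x i v := by
  calc ∑ j ∈ R, f j (.mid i) ≤ ∑ j ∈ R, ∑ v ∈ R, f j (.sx v i) := by
        refine Finset.sum_le_sum fun j hj => ?_
        have h : ∑ v ∈ R, f j (.sx v i) = ∑ v, f j (.sx v i) :=
          Finset.sum_subset (Finset.subset_univ R) fun v _ hv =>
            hf.sx_eq_zero (by rintro rfl; exact hv hj) (hR v hv) i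
        rw [h, ← hf.mid_add_sum_gs]
        linarith [Finset.sum_nonneg fun v (_ : v ∈ Finset.univ) => hf.1 j (.gs i v)]
    _ = ∑ v ∈ R, ∑ j ∈ R, f j (.sx v i) := Finset.sum_comm
    _ ≤ ∑ v ∈ R, x i v := Finset.sum_le_sum fun v _ =>
        (Finset.sum_le_sum_of_subset_of_nonneg (Finset.subset_univ R)
          fun j _ _ => hf.1 j _).trans (hf.2.2.2 (.sx v i))

end IsFeasibleFlow

/-- A nonnegative vector can be concentrated on `p` or on its complement, keeping its total and at
most doubling each entry. -/
lemma exists_concentrate (p : F → Prop) (t : F → ℝ) (ht : ∀ i, 0 ≤ t i) :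
    ∃ w : F → ℝ, (∀ i, 0 ≤ w i) ∧ (∀ i, w i ≤ 2 * t i) ∧ ∑ i, w i = ∑ i, t i ∧
      ((∀ i, p i → w i = 0) ∨ ∀ i, ¬ p i → w i = 0) := by
  have key (q : F → Prop) [DecidablePred q] (hq : ∑ i, t i ≤ 2 * ∑ i, if q i then t i else 0) :
      ∃ w : F → ℝ, (∀ i, 0 ≤ w i) ∧ (∀ i, w i ≤ 2 * t i) ∧ ∑ i, w i = ∑ i, t i ∧
        ∀ i, ¬ q i → w i = 0 := by
    set T := ∑ i, t i
    set Q := ∑ i, if q i then t i else 0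
    have hT : 0 ≤ T := Finset.sum_nonneg fun i _ => ht i
    have hr : T / Q ≤ 2 := by
      rcases (show 0 ≤ Q by linarith).eq_or_lt with h | h
      · simp [← h]
      · rwa [div_le_iff₀ h]
    have hr0 : 0 ≤ T / Q := div_nonneg hT (by linarith)
    refine ⟨fun i => T / Q * if q i then t i else 0, fun i => ?_, fun i => ?_, ?_, fun i hi => ?_⟩
    · have := ht i
      dsimp only
      split_ifs <;> positivity
    · have := ht i
      dsimp only
      split_ifs
      · nlinarith
      · simpa using this
    · rw [← Finset.mul_sum]
      rcases (show 0 ≤ Q by linarith).eq_or_lt with h | h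
      · rw [show T = 0 by linarith]
        simp
      · exact div_mul_cancel₀ T h.ne'
    · simp [hi]
  have hsplit : ∑ i, t i = (∑ i, if p i then t i else 0) + ∑ i, if ¬ p i then t i else 0 := by
    rw [← Finset.sum_add_distrib]
    refine Finset.sum_congr rfl fun i _ => ?_
    by_cases h : p i <;> simp [h]
  rcases le_total (∑ i, if p i then t i else 0) (∑ i, if ¬ p i then t i else 0) with h | h
  · obtain ⟨w, h0, h2, hs, hz⟩ := key (fun i => ¬ p i) (by linarith)
    exact ⟨w, h0, h2, hs, .inl fun i hi => hz i (not_not.2 hi)⟩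
  · obtain ⟨w, h0, h2, hs, hz⟩ := key p (by linarith)
    exact ⟨w, h0, h2, hs, .inr hz⟩

/-- Every MFNLP-feasible pair admits a semi-integral pair of cost at
most `8` times larger. -/
theorem stmt_14 (U : F → ℕ) (hU : ∀ i, 0 < U i)
    (o : F → ℝ) (ho : ∀ i, 0 ≤ o i)
    (dmet : F ⊕ D → F ⊕ D → ℝ)
    (hd0 : ∀ u, dmet u u = 0)
    (hdsym : ∀ u v, dmet u v = dmet v u)
    (hdtri : ∀ u v w, dmet u w ≤ dmet u v + dmet v w)
    (xstar : F → D → ℝ) (ystar : F → ℝ)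
    (hxs : ∀ i j, 0 ≤ xstar i j ∧ xstar i j ≤ 1)
    (hys : ∀ i, 0 ≤ ystar i ∧ ystar i ≤ 1)
    (hfeas : ∀ g : F → D → ℝ, ValidAssign U g → MFNFeasible U g xstar ystar) :
    ∃ (xhat : F → D → ℝ) (yhat : F → ℝ),
      SemiIntegral U xhat yhat ∧
        cflCost o (fun i j => dmet (Sum.inl i) (Sum.inr j)) xhat yhat ≤
          8 * cflCost o (fun i j => dmet (Sum.inl i) (Sum.inr j)) xstar ystar := by
  set c : F → D → ℝ := fun i j => dmet (Sum.inl i) (Sum.inr j) with hc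
  have hc0 : ∀ i j, 0 ≤ c i j := fun i j => by
    have := hdtri (.inl i) (.inr j) (.inl i)
    rw [hd0, hdsym (.inr j) (.inl i)] at this
    simp only [hc]
    linarith
  set u : F → D → ℝ := fun i j => if 1 / 4 < ystar i then 2 * xstar i j else 0 with hu
  have hu0 : ∀ i j, 0 ≤ u i j := fun i j => by
    have := (hxs i j).1
    simp only [hu]
    split_ifs <;> linarith
  have hux : ∀ i j, u i j ≤ 2 * xstar i j := fun i j => by
    have := (hxs i j).1
    simp only [hu]
    split_ifs <;> linarith
  obtain ⟨g, hg0, hgu, hg1, hgU, hmax⟩ :=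
    exists_maximal_capped_assignment (fun i => (U i : ℝ)) (fun i => Nat.cast_nonneg _) u hu0
  have hgS : ∀ i j, ¬ 1 / 4 < ystar i → g i j = 0 := fun i j hi =>
    le_antisymm ((hgu i j).trans_eq (if_neg hi)) (hg0 i j)
  -- clients that are not fully assigned, and the facilities reachable from them
  set R : Finset D := Finset.univ.filter fun j => ∑ i, g i j < 1 with hR
  set K : Set F := {i | ∃ j ∈ R, g i j < u i j}
  have hKI : ∀ i ∈ K, 1 / 4 < ystar i := by
    rintro i ⟨j, -, hj⟩
    by_contra hi
    have := hg0 i j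
    simp only [hu, if_neg hi] at hj
    linarith
  have hRg : ∀ j ∉ R, ∑ i, g i j = 1 := fun j hj =>
    le_antisymm (hg1 j) (by simpa [hR] using hj)
  have hKsat : ∀ i ∈ K, ∑ j, g i j = U i := by
    rintro i ⟨j, hj, hij⟩
    exact (hmax i j (by simpa [hR] using hj) hij).1
  have hKz : ∀ i ∈ K, ∀ j ∉ R, g i j = 0 := by
    rintro i ⟨j, hj, hij⟩ j' hj'
    exact (hmax i j (by simpa [hR] using hj) hij).2 j' (hRg j' hj')
  have hnK : ∀ i ∉ K, 1 / 4 < ystar i → ∀ j ∈ R, g i j = 2 * xstar i j := by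
    intro i hi hI j hj
    have h1 : u i j ≤ g i j := not_lt.1 fun h => hi ⟨j, hj, h⟩
    have h2 := hgu i j
    simp only [hu, if_pos hI] at h1 h2
    exact le_antisymm h2 h1
  set g' : F → D → ℝ := fun i j => if i ∈ K then g i j else 0 with hg'
  have hg'0 : ∀ i j, 0 ≤ g' i j := fun i j => by
    simp only [hg']
    split_ifs
    exacts [hg0 i j, le_rfl]
  have hg'g : ∀ i j, g' i j ≤ g i j := fun i j => by
    simp only [hg']
    split_ifs
    exacts [le_rfl, hg0 i j]
  obtain ⟨f, hf⟩ := hfeas g' ⟨hg'0,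
    fun j => (Finset.sum_le_sum fun i _ => hg'g i j).trans (hg1 j),
    fun i => (Finset.sum_le_sum fun j _ => hg'g i j).trans (hgU i)⟩
  have hmidK : ∀ i ∈ K, ∀ j, f j (.mid i) = 0 := fun i hi j => by
    refine le_antisymm ?_ (hf.1 _ _)
    simpa [mfnCap, hg', hi, hKsat i hi] using hf.le_cap j (.mid i)
  have hmidR : ∀ i, ∑ j ∈ R, f j (.mid i) ≤ ∑ v ∈ R, xstar i v := fun i => by
    refine hf.sum_mid_le_sum R (fun v hv i => ?_) i
    by_cases hi : i ∈ K
    · simp [hg', hi, hKz i hi v hv]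
    · simp [hg', hi]
  choose w hw0 hw2 hws hwz using fun j =>
    exists_concentrate (fun i => 1 / 4 < ystar i) (fun i => f j (.mid i)) fun i => hf.1 j _
  have hwK : ∀ i ∈ K, ∀ j, w j i = 0 := fun i hi j =>
    le_antisymm (by simpa [hmidK i hi j] using hw2 j i) (hw0 j i)
  set xhat : F → D → ℝ := fun i j => if j ∈ R then g' i j + w j i else g i j with hxhat
  set yhat : F → ℝ := fun i => if 1 / 4 < ystar i then 1 else 2 * ystar i with hyhat
  have hS : ∀ i, yhat i ≠ 1 ↔ ¬ 1 / 4 < ystar i := fun i => by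
    by_cases h : 1 / 4 < ystar i
    · simp only [hyhat, if_pos h, h, ne_eq, not_true_eq_false]
    · simp only [hyhat, if_neg h, h, not_false_eq_true, iff_true]
      intro h'
      linarith
  have hx0 : ∀ i j, 0 ≤ xhat i j := fun i j => by
    simp only [hxhat]
    split_ifs
    exacts [add_nonneg (hg'0 i j) (hw0 j i), hg0 i j]
  have hxsum : ∀ j, ∑ i, xhat i j = 1 := fun j => by
    by_cases hj : j ∈ R
    · simp only [hxhat, if_pos hj, Finset.sum_add_distrib, hws j, hf.sum_mid]
      ring
    · simp only [hxhat, if_neg hj, hRg j hj]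
  have hxSR : ∀ i, ¬ 1 / 4 < ystar i → ∀ j ∈ R, xhat i j = w j i := fun i hi j hj => by
    have : i ∉ K := fun h => hi (hKI i h)
    simp [hxhat, hj, hg', this]
  have hxSn : ∀ i, ¬ 1 / 4 < ystar i → ∀ j ∉ R, xhat i j = 0 := fun i hi j hj => by
    simp [hxhat, hj, hgS i j hi]
  have hxle : ∀ i j, xhat i j ≤ 2 * xstar i j + 2 * f j (.mid i) := fun i j => by
    have h1 := hgu i j
    have h2 := hux i j
    have h3 := hg'g i j
    have h4 := hw2 j i
    have h5 := hf.1 j (.mid i)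
    simp only [hxhat]
    split_ifs <;> linarith
  refine ⟨xhat, yhat, ⟨fun i j => ⟨hx0 i j, ?_⟩, fun i => ?_, hxsum, fun i => ?_, fun i => ?_,
    fun i hi j => ?_⟩, ?_⟩
  · rw [← hxsum j]
    exact Finset.single_le_sum (f := fun i => xhat i j) (fun i _ => hx0 i j) (Finset.mem_univ i)
  · have := hys i
    simp only [hyhat]
    split_ifs <;> constructor <;> linarith
  · by_cases hI : 1 / 4 < ystar i
    · simp only [hyhat, if_pos hI, one_mul]
      refine le_trans ?_ (hgU i)
      by_cases hi : i ∈ K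
      · refine Finset.sum_le_sum fun j _ => ?_
        simp [hxhat, hg', hi, hwK i hi j]
      · rw [← Finset.sum_add_sum_compl R, ← Finset.sum_add_sum_compl R (g i)]
        refine add_le_add ?_ (Finset.sum_le_sum fun j hj => ?_)
        · calc ∑ j ∈ R, xhat i j ≤ ∑ j ∈ R, 2 * f j (.mid i) :=
                Finset.sum_le_sum fun j hj => by simpa [hxhat, hj, hg', hi] using hw2 j i
            _ ≤ ∑ j ∈ R, 2 * xstar i j := by
                rw [← Finset.mul_sum, ← Finset.mul_sum]
                linarith [hmidR i]
            _ = ∑ j ∈ R, g i j := Finset.sum_congr rfl fun j hj => (hnK i hi hI j hj).symm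
        · simp [hxhat, Finset.mem_compl.1 hj]
    · have hiK : i ∉ K := fun h => hI (hKI i h)
      have hcap := hf.2.2.2 (.mid i)
      simp only [mfnCap, hg', if_neg hiK, Finset.sum_const_zero, sub_zero] at hcap
      calc ∑ j, xhat i j ≤ ∑ j, 2 * f j (.mid i) := Finset.sum_le_sum fun j _ => by
            by_cases hj : j ∈ R
            · exact (hxSR i hI j hj).trans_le (hw2 j i)
            · rw [hxSn i hI j hj]
              exact mul_nonneg zero_le_two (hf.1 _ _)
        _ ≤ yhat i * U i := by
            rw [← Finset.mul_sum]
            simp only [hyhat, if_neg hI]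
            linarith
  · by_cases hI : 1 / 4 < ystar i
    · exact .inl (if_pos hI)
    · right
      simp only [hyhat, if_neg hI]
      linarith
  · have hI := (hS i).1 hi
    have hy0 : 0 ≤ yhat i := by
      simp only [hyhat, if_neg hI]
      linarith [(hys i).1]
    by_cases hj : j ∈ R
    · rcases hwz j with hz | hz
      · have hsum : ∑ i' ∈ Finset.univ.filter (fun i' => yhat i' ≠ 1), xhat i' j =
            1 - ∑ i', g' i' j := by
          rw [← hf.sum_mid j, ← hws j, Finset.sum_filter]
          refine Finset.sum_congr rfl fun i' _ => ?_
          by_cases h : 1 / 4 < ystar i'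
          · rw [if_neg fun h' => (hS i').1 h' h, hz i' h]
          · rw [if_pos ((hS i').2 h), hxSR i' h j hj]
        rw [hsum, hxSR i hI j hj]
        have h1 := hw2 j i
        have h2 := hf.mid_le j i
        simp only [hyhat, if_neg hI]
        linarith
      · rw [hxSR i hI j hj, hz i hI]
        exact mul_nonneg hy0 (Finset.sum_nonneg fun i' _ => hx0 i' j)
    · rw [hxSn i hI j hj]
      exact mul_nonneg hy0 (Finset.sum_nonneg fun i' _ => hx0 i' j)
  · have hopen : ∑ i, o i * yhat i ≤ 8 * ∑ i, o i * ystar i := by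
      rw [Finset.mul_sum]
      refine Finset.sum_le_sum fun i _ => ?_
      rw [mul_left_comm]
      refine mul_le_mul_of_nonneg_left ?_ (ho i)
      have := (hys i).1
      simp only [hyhat]
      split_ifs <;> linarith
    have hflow : ∑ i, ∑ j, c i j * f j (.mid i) ≤ 3 * ∑ i, ∑ j, c i j * xstar i j := by
      refine (hf.sum_cost_mid_le hd0 hdsym hdtri).trans ?_
      simp only [Finset.mul_sum]
      refine Finset.sum_le_sum fun i _ => Finset.sum_le_sum fun j _ => ?_
      rw [mul_left_comm]
      exact mul_le_mul_of_nonneg_left (by linarith [hg'g i j, hgu i j, hux i j]) (hc0 i j)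
    have hconn : ∑ i, ∑ j, c i j * xhat i j ≤
        2 * ∑ i, ∑ j, c i j * xstar i j + 2 * ∑ i, ∑ j, c i j * f j (.mid i) := by
      simp only [Finset.mul_sum, ← Finset.sum_add_distrib]
      refine Finset.sum_le_sum fun i _ => Finset.sum_le_sum fun j _ => ?_
      rw [mul_left_comm 2, mul_left_comm 2, ← mul_add]
      exact mul_le_mul_of_nonneg_left (hxle i j) (hc0 i j)
    simp only [cflCost]
    linarith
end

section
/- For every semi-integral pair (x̂,ŷ) there exists an integral solution (x̄,ȳ) to the CFL instance with c(x̄,ȳ) ≤ 36·c(x̂,ŷ). -/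
/-!
Formalization of statements from "An LP-rounding approach to capacitated facility location".

`F` is the (finite) type of facilities, `D` the type of clients, `U i` the (positive integer)
capacity of facility `i`.  The multi-commodity flow network `MFN(g, x, y)` has nodes
`j^s, j^t` for clients `j` and `i, i'` for facilities `i`; its arcs and capacities are as in
`MFNArc` / `mfnCap` below.
-/

open scoped BigOperators Classical

variable {F D : Type}

variable [Fintype F] [Fintype D]

/-- `(x, y)` is an integral solution of the capacitated facility location instance. -/
def IsIntegralSolution (U : F → ℕ) (x : F → D → ℝ) (y : F → ℝ) : Prop :=
  (∀ i j, x i j = 0 ∨ x i j = 1) ∧ (∀ i, y i = 0 ∨ y i = 1) ∧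
  (∀ i j, x i j ≤ y i) ∧ (∀ j, ∑ i, x i j = 1) ∧
  (∀ i, ∑ j, x i j ≤ (U i : ℝ) * y i)

theorem exists_dual_charging {ι κ : Type*} (T : κ → Finset ι) (R : κ → ℝ) (o : ι → ℝ)
    (ho : ∀ i, 0 ≤ o i) (J : Finset κ) (hT : ∀ j ∈ J, (T j).Nonempty) :
    ∃ θ : κ → ℝ, (∀ j, 0 ≤ θ j) ∧ (∀ i, ∑ j ∈ J with i ∈ T j, θ j ≤ o i) ∧
      ∀ j ∈ J, ∃ z ∈ T j, ∑ j' ∈ J with z ∈ T j', θ j' = o z ∧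
        ∀ j' ∈ J, z ∈ T j' → 0 < θ j' → R j' ≤ R j := by
  induction J using Finset.induction_on_max_value R with
  | empty => exact ⟨0, by simp, by simpa using ho, by simp⟩
  | insert a J haJ hmax ih =>
    obtain ⟨θ, hθ, hpack, htight⟩ := ih fun j hj => hT j (Finset.mem_insert_of_mem hj)
    obtain ⟨z, hz, hzmin⟩ := (T a).exists_min_image
      (fun i => o i - ∑ j ∈ J with i ∈ T j, θ j) (hT a (Finset.mem_insert_self _ _))
    set s := o z - ∑ j ∈ J with z ∈ T j, θ j with hs
    have hs0 : 0 ≤ s := sub_nonneg.2 (hpack z)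
    have hJ : ∀ j ∈ J, Function.update θ a s j = θ j := fun j hj =>
      Function.update_of_ne (by rintro rfl; exact haJ hj) _ _
    have hsum : ∀ i, ∑ j ∈ insert a J with i ∈ T j, Function.update θ a s j =
        (if i ∈ T a then s else 0) + ∑ j ∈ J with i ∈ T j, θ j := fun i => by
      rw [Finset.sum_filter, Finset.sum_insert haJ, Function.update_self, Finset.sum_filter]
      congr 1
      exact Finset.sum_congr rfl fun j hj => by rw [hJ j hj]
    refine ⟨Function.update θ a s, fun j => ?_, fun i => ?_, fun j hj => ?_⟩
    · rcases eq_or_ne j a with rfl | h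
      · simpa using hs0
      · simpa [h] using hθ j
    · rw [hsum]
      split_ifs with hi
      · linarith [hzmin i hi]
      · simpa using hpack i
    · rcases Finset.mem_insert.1 hj with rfl | hjJ
      · refine ⟨z, hz, by rw [hsum, if_pos hz]; ring, fun j' hj' _ _ => ?_⟩
        rcases Finset.mem_insert.1 hj' with rfl | h
        · exact le_rfl
        · exact hmax _ h
      · obtain ⟨w, hw, hwo, hwR⟩ := htight j hjJ
        by_cases hwa : w ∈ T a
        · have : s = 0 := le_antisymm (by simpa [hwo] using hzmin w hwa) hs0
          refine ⟨w, hw, by rw [hsum, this, hwo]; simp, fun j' hj' hw' hpos => ?_⟩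
          rcases Finset.mem_insert.1 hj' with rfl | h
          · simp [this] at hpos
          · exact hwR j' h hw' (by rwa [hJ j' h] at hpos)
        · refine ⟨w, hw, by rw [hsum, if_neg hwa, hwo, zero_add], fun j' hj' hw' hpos => ?_⟩
          rcases Finset.mem_insert.1 hj' with rfl | h
          · exact absurd hw' hwa
          · exact hwR j' h hw' (by rwa [hJ j' h] at hpos)

theorem exists_sparse_dominating {ι κ : Type*} (T : κ → Finset ι) (C : Finset κ) (U : ι → ℕ)
    (Z : Finset ι) :
    ∃ H ⊆ Z, (∀ j ∈ C, (H ∩ T j).card ≤ 1) ∧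
      ∀ z ∈ Z, ∃ h ∈ H, U z ≤ U h ∧ (h = z ∨ ∃ j ∈ C, z ∈ T j ∧ h ∈ T j) := by
  induction Z using Finset.induction_on_min_value U with
  | empty => exact ⟨∅, by simp, by simp, by simp⟩
  | insert a Z haZ hmin ih =>
    obtain ⟨H, hHZ, hcard, hdom⟩ := ih
    by_cases hblock : ∃ j ∈ C, a ∈ T j ∧ (H ∩ T j).Nonempty
    · obtain ⟨j, hj, haj, h, hh⟩ := hblock
      rw [Finset.mem_inter] at hh
      refine ⟨H, hHZ.trans (Finset.subset_insert _ _), hcard, fun z hz => ?_⟩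
      rcases Finset.mem_insert.1 hz with rfl | hz
      · exact ⟨h, hh.1, hmin h (hHZ hh.1), Or.inr ⟨j, hj, haj, hh.2⟩⟩
      · exact hdom z hz
    · push Not at hblock
      refine ⟨insert a H, Finset.insert_subset_insert _ hHZ, fun j hj => ?_, fun z hz => ?_⟩
      · by_cases haj : a ∈ T j
        · rw [Finset.insert_inter_of_mem haj, hblock j hj haj]
          simp
        · rw [Finset.insert_inter_of_notMem haj]
          exact hcard j hj
      · rcases Finset.mem_insert.1 hz with rfl | hz
        · exact ⟨z, Finset.mem_insert_self _ _, le_rfl, Or.inl rfl⟩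
        · obtain ⟨h, hh, hU, hor⟩ := hdom z hz
          exact ⟨h, Finset.mem_insert_of_mem hh, hU, hor⟩

theorem exists_hitting_set {ι κ : Type*} [Fintype ι] (T : κ → Finset ι) (R : κ → ℝ)
    (U : ι → ℕ) (o y : ι → ℝ) (ho : ∀ i, 0 ≤ o i) (S : Finset ι) (hy : ∀ i ∈ S, 0 ≤ y i)
    (J : Finset κ) (hTS : ∀ j ∈ J, T j ⊆ S) {η : ℝ} (hη : 0 < η)
    (hT : ∀ j ∈ J, η ≤ ∑ i ∈ T j, y i) :
    ∃ H ⊆ S, η * ∑ i ∈ H, o i ≤ ∑ i ∈ S, o i * y i ∧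
      ∀ j ∈ J, ∃ z ∈ T j, ∃ h ∈ H, U z ≤ U h ∧
        ∃ j' ∈ J, R j' ≤ R j ∧ z ∈ T j' ∧ h ∈ T j' := by
  have hne : ∀ j ∈ J, (T j).Nonempty := fun j hj => by
    by_contra h
    have := hT j hj
    rw [Finset.not_nonempty_iff_eq_empty.1 h, Finset.sum_empty] at this
    linarith
  obtain ⟨θ, hθ, hpack, htight⟩ := exists_dual_charging T R o ho J hne
  obtain ⟨H, hHZ, hcard, hdom⟩ := exists_sparse_dominating T (J.filter fun j => 0 < θ j) U
    (S.filter fun z => ∑ j ∈ J with z ∈ T j, θ j = o z)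
  refine ⟨H, hHZ.trans (Finset.filter_subset _ _), ?_, fun j hj => ?_⟩
  · have h1 : ∑ i ∈ H, o i ≤ ∑ j ∈ J, θ j := by
      calc ∑ i ∈ H, o i = ∑ i ∈ H, ∑ j ∈ J, if i ∈ T j then θ j else 0 :=
            Finset.sum_congr rfl fun i hi => by
              rw [← Finset.sum_filter, (Finset.mem_filter.1 (hHZ hi)).2]
        _ = ∑ j ∈ J, ((H ∩ T j).card : ℝ) * θ j := by
            rw [Finset.sum_comm]
            refine Finset.sum_congr rfl fun j _ => ?_
            rw [← Finset.sum_filter, Finset.filter_mem_eq_inter, Finset.sum_const, nsmul_eq_mul]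
        _ ≤ ∑ j ∈ J, θ j := Finset.sum_le_sum fun j hj => by
            rcases (hθ j).eq_or_lt with h | h
            · rw [← h, mul_zero]
            · have : ((H ∩ T j).card : ℝ) ≤ 1 := by
                exact_mod_cast hcard j (Finset.mem_filter.2 ⟨hj, h⟩)
              nlinarith
    have h2 : η * ∑ j ∈ J, θ j ≤ ∑ i ∈ S, o i * y i := by
      calc η * ∑ j ∈ J, θ j = ∑ j ∈ J, η * θ j := Finset.mul_sum _ _ _
        _ ≤ ∑ j ∈ J, ∑ i ∈ S, if i ∈ T j then θ j * y i else 0 :=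
            Finset.sum_le_sum fun j hj => by
              rw [← Finset.sum_filter, Finset.filter_mem_eq_inter,
                Finset.inter_eq_right.2 (hTS j hj), ← Finset.mul_sum, mul_comm]
              exact mul_le_mul_of_nonneg_left (hT j hj) (hθ j)
        _ = ∑ i ∈ S, (∑ j ∈ J with i ∈ T j, θ j) * y i := by
            rw [Finset.sum_comm]
            refine Finset.sum_congr rfl fun i _ => ?_
            rw [← Finset.sum_filter, Finset.sum_mul]
        _ ≤ ∑ i ∈ S, o i * y i := Finset.sum_le_sum fun i hi =>
            mul_le_mul_of_nonneg_right (hpack i) (hy i hi)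
    exact (mul_le_mul_of_nonneg_left h1 hη.le).trans h2
  · obtain ⟨z, hz, hzo, hzR⟩ := htight j hj
    obtain ⟨h, hh, hU, hor⟩ := hdom z (Finset.mem_filter.2 ⟨hTS j hj hz, hzo⟩)
    refine ⟨z, hz, h, hh, hU, ?_⟩
    rcases hor with rfl | ⟨j', hj', hzj', hhj'⟩
    · exact ⟨j, hj, le_rfl, hz, hz⟩
    · rw [Finset.mem_filter] at hj'
      exact ⟨j', hj'.1, hzR j' hj'.1 hzj' hj'.2, hzj', hhj'⟩

theorem exists_initial_segment {ι : Type*} (key y : ι → ℝ) {σ : ℝ} (hσ : 0 ≤ σ) (A : Finset ι)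
    (hy : ∀ i ∈ A, y i ≤ σ) (hA : σ ≤ ∑ i ∈ A, y i) :
    ∃ P ⊆ A, σ ≤ ∑ i ∈ P, y i ∧ ∑ i ∈ P, y i ≤ 2 * σ ∧
      ∀ p ∈ P, ∀ q ∈ A, q ∉ P → key p ≤ key q := by
  induction A using Finset.induction_on_max_value key with
  | empty =>
    refine ⟨∅, subset_rfl, hA, ?_, by simp⟩
    simpa using hσ
  | insert a A haA hmax ih =>
    by_cases h : σ ≤ ∑ i ∈ A, y i
    · obtain ⟨P, hPA, h1, h2, h3⟩ := ih (fun i hi => hy i (Finset.mem_insert_of_mem hi)) h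
      refine ⟨P, hPA.trans (Finset.subset_insert _ _), h1, h2, fun p hp q hq hqP => ?_⟩
      rcases Finset.mem_insert.1 hq with rfl | hq
      · exact hmax p (hPA hp)
      · exact h3 p hp q hq hqP
    · refine ⟨_, subset_rfl, hA, ?_, fun p _ q hq hq' => absurd hq hq'⟩
      rw [Finset.sum_insert haA]
      linarith [hy a (Finset.mem_insert_self _ _)]

theorem exists_block_representatives {ι α : Type*} [DecidableEq α] (g : ι → α) (key o y : ι → ℝ) {σ : ℝ}
    (hσ : 0 < σ) (ho : ∀ i, 0 ≤ o i) (G : Finset ι) (hy0 : ∀ i ∈ G, 0 ≤ y i)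
    (hy : ∀ i ∈ G, y i ≤ σ) :
    ∃ T ⊆ G, ∃ φ : ι → Option ι,
      (∀ i ∈ G, ∀ t, φ i = some t → t ∈ T ∧ g t = g i ∧ key t ≤ key i) ∧
      (∀ t, ∑ i ∈ G with φ i = some t, y i ≤ 2 * σ) ∧
      (∀ a, ∑ i ∈ G with g i = a ∧ φ i = none, y i ≤ 2 * σ) ∧
      σ * ∑ i ∈ T, o i ≤ ∑ i ∈ G, o i * y i := by
  induction G using Finset.strongInduction with
  | H G ih =>
    by_cases hbig : ∃ a, σ ≤ ∑ i ∈ G with g i = a, y i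
    · obtain ⟨a, ha⟩ := hbig
      obtain ⟨P, hPA, hP1, hP2, hPkey⟩ := exists_initial_segment key y hσ.le
        (G.filter fun i => g i = a) (fun i hi => hy i (Finset.mem_filter.1 hi).1) ha
      have hPG : P ⊆ G := hPA.trans (Finset.filter_subset _ _)
      have hPg : ∀ i ∈ P, g i = a := fun i hi => (Finset.mem_filter.1 (hPA hi)).2
      have hPne : P.Nonempty := by
        by_contra h
        rw [Finset.not_nonempty_iff_eq_empty.1 h, Finset.sum_empty] at hP1
        linarith
      obtain ⟨t, htP, htmin⟩ := P.exists_min_image o hPne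
      obtain ⟨T, hTG, φ, hφ, hrep, hnone, hcost⟩ := ih (G \ P)
        (Finset.sdiff_ssubset hPG hPne) (fun i hi => hy0 i (Finset.mem_sdiff.1 hi).1)
        (fun i hi => hy i (Finset.mem_sdiff.1 hi).1)
      have htT : t ∉ T := fun h => (Finset.mem_sdiff.1 (hTG h)).2 htP
      refine ⟨insert t T, Finset.insert_subset (hPG htP) (hTG.trans Finset.sdiff_subset),
        fun i => if i ∈ P then none else if g i = a ∧ φ i = none then some t else φ i,
        fun i hi s hs => ?_, fun s => ?_, fun b => ?_, ?_⟩
      · dsimp only at hs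
        split_ifs at hs with h1 h2
        · cases hs
          exact ⟨Finset.mem_insert_self _ _, by rw [h2.1, hPg _ htP],
            hPkey _ htP i (Finset.mem_filter.2 ⟨hi, h2.1⟩) h1⟩
        · obtain ⟨h3, h4⟩ := hφ i (Finset.mem_sdiff.2 ⟨hi, h1⟩) s hs
          exact ⟨Finset.mem_insert_of_mem h3, h4⟩
      · by_cases hst : s = t
        · subst hst
          refine le_trans (Finset.sum_le_sum_of_subset_of_nonneg (fun i hi => ?_)
            fun i hi _ => hy0 i ?_) (hnone a)
          · rw [Finset.mem_filter] at hi
            obtain ⟨hiG, hi⟩ := hi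
            dsimp only at hi
            split_ifs at hi with h1 h2
            · exact Finset.mem_filter.2 ⟨Finset.mem_sdiff.2 ⟨hiG, h1⟩, h2⟩
            · exact absurd (hφ i (Finset.mem_sdiff.2 ⟨hiG, h1⟩) s hi).1 htT
          · exact (Finset.mem_sdiff.1 (Finset.mem_filter.1 hi).1).1
        · refine le_trans (Finset.sum_le_sum_of_subset_of_nonneg (fun i hi => ?_)
            fun i hi _ => hy0 i ?_) (hrep s)
          · rw [Finset.mem_filter] at hi
            obtain ⟨hiG, hi⟩ := hi
            dsimp only at hi
            split_ifs at hi with h1 h2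
            · exact absurd (Option.some.inj hi).symm hst
            · exact Finset.mem_filter.2 ⟨Finset.mem_sdiff.2 ⟨hiG, h1⟩, hi⟩
          · exact (Finset.mem_sdiff.1 (Finset.mem_filter.1 hi).1).1
      · by_cases hb : b = a
        · subst hb
          refine le_trans (Finset.sum_le_sum_of_subset_of_nonneg (fun i hi => ?_)
            fun i hi _ => hy0 i (hPG hi)) hP2
          rw [Finset.mem_filter] at hi
          obtain ⟨hiG, hib, hi⟩ := hi
          dsimp only at hi
          split_ifs at hi with h1 h2
          · exact h1
          · exact absurd ⟨hib, hi⟩ h2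
        · refine le_trans (Finset.sum_le_sum_of_subset_of_nonneg (fun i hi => ?_)
            fun i hi _ => hy0 i ?_) (hnone b)
          · rw [Finset.mem_filter] at hi
            obtain ⟨hiG, hib, hi⟩ := hi
            dsimp only at hi
            split_ifs at hi with h1 h2
            · exact absurd (hib.symm.trans (hPg i h1)) hb
            · exact Finset.mem_filter.2 ⟨Finset.mem_sdiff.2 ⟨hiG, h1⟩, hib, hi⟩
          · exact (Finset.mem_sdiff.1 (Finset.mem_filter.1 hi).1).1
      · rw [Finset.sum_insert htT, mul_add, ← Finset.sum_sdiff hPG, add_comm]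
        refine add_le_add hcost ?_
        calc σ * o t ≤ (∑ i ∈ P, y i) * o t := mul_le_mul_of_nonneg_right hP1 (ho t)
          _ = ∑ i ∈ P, o t * y i := by rw [mul_comm, Finset.mul_sum]
          _ ≤ ∑ i ∈ P, o i * y i := Finset.sum_le_sum fun i hi =>
              mul_le_mul_of_nonneg_right (htmin i hi) (hy0 i (hPG hi))
    · push Not at hbig
      refine ⟨∅, by simp, fun _ => none, by simp, fun t => ?_, fun a => ?_, ?_⟩
      · simpa using hσ.le
      · simpa using (hbig a).le.trans (by linarith)
      · simpa using Finset.sum_nonneg fun i hi => mul_nonneg (ho i) (hy0 i hi)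


theorem exists_facility_consolidation {ι : Type*} (h : ι → ι) (key o y : ι → ℝ) (U : ι → ℕ)
    (W : Finset ι) (ho : ∀ i, 0 ≤ o i) (hy0 : ∀ i ∈ W, 0 ≤ y i) (hy : ∀ i ∈ W, y i ≤ 1 / 2)
    (hU : ∀ i ∈ W, 0 < U i) (hUh : ∀ i ∈ W, U i ≤ U (h i)) :
    ∃ T ⊆ W, ∃ ψ : ι → ι,
      (∀ i ∈ W, ψ i = h i ∨ ψ i ∈ T ∧ h (ψ i) = h i ∧ key (ψ i) ≤ key i) ∧
      (∀ t, ∑ i ∈ W with ψ i = t, y i * U i ≤ 2 / 3 * U t) ∧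
      ∑ i ∈ T, o i ≤ 24 * ∑ i ∈ W, o i * y i := by
  set L := W.filter fun i => 1 / 24 ≤ y i with hL
  set G := W.filter fun i => ¬ 1 / 24 ≤ y i with hG
  have hGW : ∀ i ∈ G, i ∈ W := fun i hi => (Finset.mem_filter.1 hi).1
  obtain ⟨T, hTG, φ, hφ, hrep, hnone, hcost⟩ := exists_block_representatives
    (fun i => (h i, Nat.log 2 (U (h i) / U i))) key o y (by norm_num : (0 : ℝ) < 1 / 24) ho G
    (fun i hi => hy0 i (hGW i hi)) (fun i hi => (not_le.1 (Finset.mem_filter.1 hi).2).le)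
  have hlog : ∀ i ∈ W, 2 ^ Nat.log 2 (U (h i) / U i) * U i ≤ U (h i) := fun i hi => by
    have h1 : U (h i) / U i ≠ 0 := (Nat.div_pos (hUh i hi) (hU i hi)).ne'
    exact (Nat.le_div_iff_mul_le (hU i hi)).1 (Nat.pow_log_le_self 2 h1)
  have hlog' : ∀ i ∈ W, U (h i) < 2 ^ (Nat.log 2 (U (h i) / U i) + 1) * U i := fun i hi =>
    (Nat.div_lt_iff_lt_mul (hU i hi)).1 (Nat.lt_pow_succ_log_self one_lt_two _)
  set ψ : ι → ι := fun i => if 1 / 24 ≤ y i then i else (φ i).getD (h i) with hψ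
  have hψL : ∀ i, 1 / 24 ≤ y i → ψ i = i := fun i hi => if_pos hi
  have hψG : ∀ i, ¬ 1 / 24 ≤ y i → ψ i = (φ i).getD (h i) := fun i hi => if_neg hi
  have hyU : ∀ i ∈ W, 0 ≤ y i * U i := fun i hi => mul_nonneg (hy0 i hi) (Nat.cast_nonneg _)
  refine ⟨L ∪ T, Finset.union_subset (Finset.filter_subset _ _)
    (hTG.trans (Finset.filter_subset _ _)), ψ, fun i hi => ?_, fun t => ?_, ?_⟩
  · by_cases hi' : 1 / 24 ≤ y i
    · rw [hψL i hi']
      exact Or.inr ⟨Finset.mem_union_left _ (Finset.mem_filter.2 ⟨hi, hi'⟩), rfl, le_rfl⟩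
    · rw [hψG i hi']
      cases hφi : φ i with
      | none => exact Or.inl rfl
      | some t =>
        obtain ⟨h1, h2, h3⟩ := hφ i (Finset.mem_filter.2 ⟨hi, hi'⟩) t hφi
        exact Or.inr ⟨Finset.mem_union_right _ h1, congrArg Prod.fst h2, h3⟩
  · have hA : ∑ i ∈ L with ψ i = t, y i * U i ≤ if t ∈ G then 0 else 1 / 2 * (U t : ℝ) := by
      have hsub : ∀ i ∈ L.filter (fun i => ψ i = t), i = t ∧ t ∈ L := fun i hi => by
        rw [Finset.mem_filter] at hi
        have := hψL i (Finset.mem_filter.1 hi.1).2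
        have h2 : i = t := this.symm.trans hi.2
        exact ⟨h2, h2 ▸ hi.1⟩
      split_ifs with htG
      · refine (Finset.sum_eq_zero fun i hi => ?_).le
        exact absurd (Finset.mem_filter.1 (hsub i hi).2).2 (Finset.mem_filter.1 htG).2
      · by_cases htL : t ∈ L
        · refine (Finset.sum_le_sum_of_subset_of_nonneg (t := {t})
            (fun i hi => Finset.mem_singleton.2 (hsub i hi).1) fun i hi _ => ?_).trans ?_
          · rw [Finset.mem_singleton.1 hi]
            exact hyU t (Finset.mem_filter.1 htL).1
          · rw [Finset.sum_singleton]
            exact mul_le_mul_of_nonneg_right (hy t (Finset.mem_filter.1 htL).1)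
              (Nat.cast_nonneg _)
        · rw [Finset.sum_eq_zero fun i hi => absurd (hsub i hi).2 htL]
          positivity
    have hB : ∑ i ∈ G with φ i = some t, y i * U i ≤ if t ∈ G then 1 / 6 * (U t : ℝ) else 0 := by
      have hsub : ∀ i ∈ G.filter (fun i => φ i = some t), t ∈ G ∧ (U i : ℝ) ≤ 2 * U t :=
        fun i hi => by
          rw [Finset.mem_filter] at hi
          obtain ⟨h1, h2, -⟩ := hφ i hi.1 t hi.2
          simp only [Prod.mk.injEq] at h2
          refine ⟨hTG h1, ?_⟩
          have h3 := hlog i (hGW i hi.1)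
          have h4 := hlog' t (hGW t (hTG h1))
          rw [h2.2, h2.1, pow_succ, mul_assoc] at h4
          exact_mod_cast (lt_of_mul_lt_mul_left (h3.trans_lt h4) (Nat.zero_le _)).le
      split_ifs with htG
      · calc ∑ i ∈ G with φ i = some t, y i * U i
            ≤ ∑ i ∈ G with φ i = some t, y i * (2 * U t) := Finset.sum_le_sum fun i hi =>
              mul_le_mul_of_nonneg_left (hsub i hi).2
                (hy0 i (hGW i (Finset.mem_filter.1 hi).1))
          _ = (∑ i ∈ G with φ i = some t, y i) * (2 * U t) := (Finset.sum_mul _ _ _).symm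
          _ ≤ (2 * (1 / 24)) * (2 * U t) :=
              mul_le_mul_of_nonneg_right (hrep t) (by positivity)
          _ = 1 / 6 * (U t : ℝ) := by ring
      · exact (Finset.sum_eq_zero fun i hi => absurd (hsub i hi).1 htG).le
    have hC : ∑ i ∈ G with h i = t ∧ φ i = none, y i * U i ≤ 1 / 6 * (U t : ℝ) := by
      have hmaps : ∀ i ∈ G.filter (fun i => h i = t ∧ φ i = none),
          Nat.log 2 (U t / U i) ∈ Finset.range (U t + 1) := fun i _ =>
        Finset.mem_range.2 (Nat.lt_succ_of_le
          ((Nat.log_le_self 2 _).trans (Nat.div_le_self _ _)))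
      rw [← Finset.sum_fiberwise_of_maps_to hmaps]
      calc ∑ k ∈ Finset.range (U t + 1), ∑ i ∈ G.filter (fun i => h i = t ∧ φ i = none) with
              Nat.log 2 (U t / U i) = k, y i * (U i : ℝ)
          ≤ ∑ k ∈ Finset.range (U t + 1), (1 / 12 * U t) * (1 / 2 : ℝ) ^ k :=
            Finset.sum_le_sum fun k _ => ?_
        _ = (1 / 12 * U t) * ∑ k ∈ Finset.range (U t + 1), (1 / 2 : ℝ) ^ k :=
            (Finset.mul_sum _ _ _).symm
        _ ≤ (1 / 12 * U t) * 2 :=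
            mul_le_mul_of_nonneg_left (sum_geometric_two_le _) (by positivity)
        _ = 1 / 6 * (U t : ℝ) := by ring
      have hmass : ∑ i ∈ G.filter (fun i => h i = t ∧ φ i = none) with
          Nat.log 2 (U t / U i) = k, y i ≤ 1 / 12 := by
        refine le_trans (Finset.sum_le_sum_of_subset_of_nonneg (fun i hi => ?_)
          fun i hi _ => hy0 i (hGW i (Finset.mem_filter.1 hi).1))
          ((hnone (t, k)).trans (by norm_num))
        simp only [Finset.mem_filter] at hi
        obtain ⟨⟨hiG, rfl, hi1⟩, hi2⟩ := hi
        exact Finset.mem_filter.2 ⟨hiG, by rw [hi2], hi1⟩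
      calc ∑ i ∈ G.filter (fun i => h i = t ∧ φ i = none) with
            Nat.log 2 (U t / U i) = k, y i * (U i : ℝ)
          ≤ ∑ i ∈ G.filter (fun i => h i = t ∧ φ i = none) with
              Nat.log 2 (U t / U i) = k, y i * (U t * (1 / 2 : ℝ) ^ k) :=
            Finset.sum_le_sum fun i hi => by
              simp only [Finset.mem_filter] at hi
              obtain ⟨⟨hiG, rfl, -⟩, rfl⟩ := hi
              refine mul_le_mul_of_nonneg_left ?_ (hy0 i (hGW i hiG))
              have h1 : ((2 : ℝ) ^ Nat.log 2 (U (h i) / U i)) * U i ≤ U (h i) := by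
                exact_mod_cast hlog i (hGW i hiG)
              rw [one_div, inv_pow, ← div_eq_mul_inv, le_div_iff₀ (by positivity), mul_comm]
              exact h1
        _ = (∑ i ∈ G.filter (fun i => h i = t ∧ φ i = none) with
              Nat.log 2 (U t / U i) = k, y i) * (U t * (1 / 2 : ℝ) ^ k) :=
            (Finset.sum_mul _ _ _).symm
        _ ≤ 1 / 12 * (U t * (1 / 2 : ℝ) ^ k) :=
            mul_le_mul_of_nonneg_right hmass (by positivity)
        _ = (1 / 12 * U t) * (1 / 2 : ℝ) ^ k := by ring
    have hBC : ∑ i ∈ G with ψ i = t, y i * U i ≤ ∑ i ∈ G with φ i = some t, y i * (U i : ℝ) +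
        ∑ i ∈ G with h i = t ∧ φ i = none, y i * (U i : ℝ) := by
      rw [← Finset.sum_union]
      · refine Finset.sum_le_sum_of_subset_of_nonneg (fun i hi => ?_) fun i hi _ => ?_
        · rw [Finset.mem_filter] at hi
          have h1 := hψG i (Finset.mem_filter.1 hi.1).2
          rw [hi.2] at h1
          cases hφi : φ i with
          | none =>
            exact Finset.mem_union_right _
              (Finset.mem_filter.2 ⟨hi.1, by rw [h1, hφi]; rfl, hφi⟩)
          | some s =>
            exact Finset.mem_union_left _ (Finset.mem_filter.2 ⟨hi.1, by rw [h1, hφi]; rfl⟩)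
        · exact hyU i (hGW i ((Finset.mem_union.1 hi).elim (fun h => (Finset.mem_filter.1 h).1)
            fun h => (Finset.mem_filter.1 h).1))
      · refine Finset.disjoint_left.2 fun i hi hi' => ?_
        have h1 := (Finset.mem_filter.1 hi).2
        rw [(Finset.mem_filter.1 hi').2.2] at h1
        cases h1
    have hLG : ∑ i ∈ W with ψ i = t, y i * (U i : ℝ) =
        ∑ i ∈ L with ψ i = t, y i * (U i : ℝ) + ∑ i ∈ G with ψ i = t, y i * (U i : ℝ) := by
      rw [hL, hG, Finset.filter_comm, Finset.filter_comm (fun i => ¬ 1 / 24 ≤ y i),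
        Finset.sum_filter_add_sum_filter_not]
    rw [hLG]
    split_ifs at hA hB <;> linarith [(Nat.cast_nonneg (U t) : (0 : ℝ) ≤ U t)]
  · have h1 : ∑ i ∈ L, o i ≤ 24 * ∑ i ∈ L, o i * y i := by
      rw [Finset.mul_sum]
      exact Finset.sum_le_sum fun i hi => by nlinarith [ho i, (Finset.mem_filter.1 hi).2]
    have h2 : ∑ i ∈ L ∪ T, o i ≤ ∑ i ∈ L, o i + ∑ i ∈ T, o i := by
      rw [← Finset.sum_union_inter]
      exact le_add_of_nonneg_right (Finset.sum_nonneg fun i _ => ho i)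
    have h3 := Finset.sum_filter_add_sum_filter_not W (fun i => 1 / 24 ≤ y i) fun i => o i * y i
    rw [← h3]
    linarith

theorem exists_radius_threshold {ι : Type*} (S : Finset ι) (x c y : ι → ℝ) (U : ι → ℕ)
    (hx : ∀ i ∈ S, 0 ≤ x i) (hc : ∀ i ∈ S, 0 ≤ c i) (hd : 0 < ∑ i ∈ S, x i)
    (hxy : ∀ i ∈ S, x i ≤ y i * ∑ i ∈ S, x i) :
    ∃ (R : ℝ) (u : ℕ), R * ∑ i ∈ S, x i = 4 * ∑ i ∈ S, c i * x i ∧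
      1 / 12 ≤ ∑ i ∈ S with c i ≤ R ∧ u ≤ U i, y i ∧
      2 / 3 * ∑ i ∈ S, x i ≤ ∑ i ∈ S with c i ≤ R ∧ U i ≤ u, x i := by
  set d := ∑ i ∈ S, x i with hd'
  set R := 4 * (∑ i ∈ S, c i * x i) / d with hR
  have hRd : R * d = 4 * ∑ i ∈ S, c i * x i := div_mul_cancel₀ _ hd.ne'
  have hcx : ∀ i ∈ S, 0 ≤ c i * x i := fun i hi => mul_nonneg (hc i hi) (hx i hi)
  have hR0 : 0 ≤ R := div_nonneg (by linarith [Finset.sum_nonneg hcx]) hd.le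
  have hsplit := Finset.sum_filter_add_sum_filter_not S (fun i => c i ≤ R) x
  have hnear : 3 / 4 * d ≤ ∑ i ∈ S with c i ≤ R, x i := by
    suffices h : ∑ i ∈ S with ¬ c i ≤ R, x i ≤ d / 4 by linarith
    rcases hR0.eq_or_lt with h0 | h0
    · have h1 : ∑ i ∈ S, c i * x i = 0 := by
        rw [← h0, zero_mul] at hRd
        linarith
      rw [Finset.sum_eq_zero_iff_of_nonneg hcx] at h1
      rw [Finset.sum_eq_zero]
      · positivity
      · intro i hi
        rw [Finset.mem_filter] at hi
        have h2 : 0 < c i := by linarith [not_le.1 hi.2]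
        exact (mul_eq_zero.1 (h1 i hi.1)).resolve_left h2.ne'
    · have h1 : R * ∑ i ∈ S with ¬ c i ≤ R, x i ≤ ∑ i ∈ S, c i * x i := by
        rw [Finset.mul_sum]
        refine le_trans (Finset.sum_le_sum fun i hi => ?_)
          (Finset.sum_le_sum_of_subset_of_nonneg (Finset.filter_subset _ _)
            fun i hi _ => hcx i hi)
        rw [Finset.mem_filter] at hi
        exact mul_le_mul_of_nonneg_right (not_le.1 hi.2).le (hx i hi.1)
      refine le_of_mul_le_mul_left (h1.trans ?_) h0
      linarith
  have hex : ∃ n, ¬ d / 12 ≤ ∑ i ∈ S with c i ≤ R ∧ n ≤ U i, x i := by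
    refine ⟨S.sup U + 1, ?_⟩
    rw [Finset.sum_eq_zero]
    · rw [not_le]
      positivity
    · intro i hi
      rw [Finset.mem_filter] at hi
      have := Finset.le_sup (f := U) hi.1
      omega
  have hpos : Nat.find hex ≠ 0 := fun h => by
    have := Nat.find_spec hex
    rw [h] at this
    simp only [Nat.zero_le, and_true] at this
    linarith
  obtain ⟨u, hu⟩ := Nat.exists_eq_succ_of_ne_zero hpos
  have h1 : d / 12 ≤ ∑ i ∈ S with c i ≤ R ∧ u ≤ U i, x i :=
    not_not.1 (Nat.find_min hex (by omega))
  have h2 := Nat.find_spec hex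
  rw [hu, not_le] at h2
  refine ⟨R, u, hRd, ?_, ?_⟩
  · have h3 : ∑ i ∈ S with c i ≤ R ∧ u ≤ U i, x i ≤
        (∑ i ∈ S with c i ≤ R ∧ u ≤ U i, y i) * d := by
      rw [Finset.sum_mul]
      exact Finset.sum_le_sum fun i hi => hxy i (Finset.mem_filter.1 hi).1
    refine le_of_mul_le_mul_right (le_trans ?_ (h1.trans h3)) hd
    linarith
  · have h3 := Finset.sum_filter_add_sum_filter_not (S.filter fun i => c i ≤ R)
      (fun i => u + 1 ≤ U i) x
    simp only [Finset.filter_filter, Nat.not_le, Nat.lt_succ_iff] at h3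
    simp only [Nat.succ_eq_add_one] at h2
    linarith

theorem exists_consolidated_assignment {ι κ : Type*} [Fintype ι] [Fintype κ] (U : ι → ℕ)
    (hU : ∀ i, 0 < U i) (o : ι → ℝ) (ho : ∀ i, 0 ≤ o i) (δ : ι ⊕ κ → ι ⊕ κ → ℝ)
    (hδ0 : ∀ a, δ a a = 0) (hδsymm : ∀ a b, δ a b = δ b a)
    (hδtri : ∀ a b c, δ a c ≤ δ a b + δ b c) (S : Finset ι) (x : ι → κ → ℝ) (y : ι → ℝ)
    (hx : ∀ i j, 0 ≤ x i j) (hy0 : ∀ i, 0 ≤ y i) (hy : ∀ i ∈ S, y i ≤ 1 / 2)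
    (hcap : ∀ i, ∑ j, x i j ≤ y i * U i)
    (hxy : ∀ i ∈ S, ∀ j, x i j ≤ y i * ∑ i' ∈ S, x i' j) :
    ∃ O ⊆ S, ∃ X : ι → κ → ℝ, (∀ i j, 0 ≤ X i j) ∧ (∀ i, i ∉ O → ∀ j, X i j = 0) ∧
      (∀ j, ∑ i, X i j = ∑ i ∈ S, x i j) ∧ (∀ i, ∑ j, X i j ≤ U i) ∧
      ∑ i, ∑ j, δ (Sum.inl i) (Sum.inr j) * X i j ≤
        36 * ∑ i ∈ S, ∑ j, δ (Sum.inl i) (Sum.inr j) * x i j ∧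
      ∑ i ∈ O, o i ≤ 36 * ∑ i ∈ S, o i * y i := by
  have hδnn : ∀ a b, 0 ≤ δ a b := fun a b => by
    have := hδtri a b a
    rw [hδ0, hδsymm b a] at this
    linarith
  set d : κ → ℝ := fun j => ∑ i ∈ S, x i j with hd
  have hdnn : ∀ j, 0 ≤ d j := fun j => Finset.sum_nonneg fun i _ => hx i j
  have hradius : ∀ j, ∃ (R : ℝ) (u : ℕ), 0 < d j →
      R * d j = 4 * ∑ i ∈ S, δ (Sum.inl i) (Sum.inr j) * x i j ∧
      1 / 12 ≤ ∑ i ∈ S with δ (Sum.inl i) (Sum.inr j) ≤ R ∧ u ≤ U i, y i ∧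
      2 / 3 * d j ≤ ∑ i ∈ S with δ (Sum.inl i) (Sum.inr j) ≤ R ∧ U i ≤ u, x i j := fun j => by
    by_cases hj : 0 < d j
    · obtain ⟨R, u, h⟩ := exists_radius_threshold S (fun i => x i j)
        (fun i => δ (Sum.inl i) (Sum.inr j)) y U (fun i _ => hx i j) (fun i _ => hδnn _ _) hj
        fun i hi => hxy i hi j
      exact ⟨R, u, fun _ => h⟩
    · exact ⟨0, 0, fun h => absurd h hj⟩
  choose R u hRu using hradius
  set J : Finset κ := Finset.univ.filter fun j => 0 < d j with hJ
  have hJd : ∀ j ∈ J, 0 < d j := fun j hj => (Finset.mem_filter.1 hj).2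
  set A : κ → Finset ι := fun j =>
    S.filter fun i => δ (Sum.inl i) (Sum.inr j) ≤ R j ∧ u j ≤ U i with hA
  set L : κ → Finset ι := fun j =>
    S.filter fun i => δ (Sum.inl i) (Sum.inr j) ≤ R j ∧ U i ≤ u j with hL
  have hAR : ∀ {i j}, i ∈ A j → δ (Sum.inl i) (Sum.inr j) ≤ R j ∧ u j ≤ U i := fun hi =>
    (Finset.mem_filter.1 hi).2
  have hLR : ∀ {i j}, i ∈ L j → δ (Sum.inl i) (Sum.inr j) ≤ R j ∧ U i ≤ u j := fun hi =>
    (Finset.mem_filter.1 hi).2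
  obtain ⟨H, hHS, hHo, hHhit⟩ := exists_hitting_set A R U o y ho S (fun i _ => hy0 i) J
    (fun j _ => Finset.filter_subset _ _) (by norm_num : (0 : ℝ) < 1 / 12)
    fun j hj => (hRu j (hJd j hj)).2.1
  have hhit : ∀ j ∈ J, ∃ h ∈ H, u j ≤ U h ∧ δ (Sum.inl h) (Sum.inr j) ≤ 3 * R j :=
    fun j hj => by
      obtain ⟨z, hz, h, hh, hzh, j', -, hRR, hzj', hhj'⟩ := hHhit j hj
      refine ⟨h, hh, (hAR hz).2.trans hzh, ?_⟩
      have h1 := hδtri (Sum.inl h) (Sum.inr j') (Sum.inr j)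
      have h2 := hδtri (Sum.inr j') (Sum.inl z) (Sum.inr j)
      rw [hδsymm (Sum.inr j') (Sum.inl z)] at h2
      linarith [(hAR hz).1, (hAR hzj').1, (hAR hhj').1]
  set W : Finset ι := S.filter fun i => ∃ j ∈ J, i ∈ L j with hW
  have hkey : ∀ i, ∃ (h : ι) (k : ℝ), i ∈ W → h ∈ H ∧ U i ≤ U h ∧
      δ (Sum.inl i) (Sum.inl h) ≤ 4 * k ∧ ∀ j ∈ J, i ∈ L j → k ≤ R j := fun i => by
    by_cases hi : i ∈ W
    · obtain ⟨j₀, hj₀, hi₀⟩ := (Finset.mem_filter.1 hi).2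
      obtain ⟨j, hj, hjmin⟩ := (J.filter fun j => i ∈ L j).exists_min_image R
        ⟨j₀, Finset.mem_filter.2 ⟨hj₀, hi₀⟩⟩
      rw [Finset.mem_filter] at hj
      obtain ⟨h, hh, huh, hdist⟩ := hhit j hj.1
      refine ⟨h, R j, fun _ => ⟨hh, (hLR hj.2).2.trans huh, ?_, fun j' hj' hi' =>
        hjmin j' (Finset.mem_filter.2 ⟨hj', hi'⟩)⟩⟩
      have h1 := hδtri (Sum.inl i) (Sum.inr j) (Sum.inl h)
      rw [hδsymm (Sum.inr j) (Sum.inl h)] at h1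
      linarith [(hLR hj.2).1]
    · exact ⟨i, 0, fun h => absurd h hi⟩
  choose h key hkey using hkey
  obtain ⟨T, hTW, ψ, hψ, hload, hTo⟩ := exists_facility_consolidation h key o y U W ho
    (fun i _ => hy0 i) (fun i hi => hy i (Finset.mem_filter.1 hi).1) (fun i _ => hU i)
    (fun i hi => (hkey i hi).2.1)
  set Λ : κ → ℝ := fun j => ∑ i ∈ L j, x i j with hΛ
  have hΛd : ∀ j ∈ J, 2 / 3 * d j ≤ Λ j := fun j hj => (hRu j (hJd j hj)).2.2
  have hΛpos : ∀ j ∈ J, 0 < Λ j := fun j hj => by linarith [hΛd j hj, hJd j hj]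
  set f : ι → κ → ℝ := fun i j => if j ∈ J ∧ i ∈ L j then x i j * (d j / Λ j) else 0 with hf
  have hf0 : ∀ i j, 0 ≤ f i j := fun i j => by
    simp only [hf]
    split_ifs with hij
    · exact mul_nonneg (hx i j) (div_nonneg (hdnn j) (hΛpos j hij.1).le)
    · exact le_rfl
  have hfx : ∀ i j, f i j ≤ 3 / 2 * x i j := fun i j => by
    simp only [hf]
    split_ifs with hij
    · rw [mul_comm (3 / 2 : ℝ)]
      refine mul_le_mul_of_nonneg_left ?_ (hx i j)
      rw [div_le_iff₀ (hΛpos j hij.1)]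
      linarith [hΛd j hij.1]
    · linarith [hx i j]
  have hLW : ∀ j ∈ J, L j ⊆ W := fun j hj i hi =>
    Finset.mem_filter.2 ⟨(Finset.mem_filter.1 hi).1, j, hj, hi⟩
  have hfsum : ∀ j, ∑ i ∈ W, f i j = d j := fun j => by
    by_cases hj : j ∈ J
    · simp only [hf, hj, true_and]
      rw [← Finset.sum_filter, Finset.filter_mem_eq_inter,
        Finset.inter_eq_right.2 (hLW j hj), ← Finset.sum_mul]
      exact mul_div_cancel₀ _ (hΛpos j hj).ne'
    · simp only [hf, hj, false_and, if_false, Finset.sum_const_zero]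
      exact le_antisymm (hdnn j) (not_lt.1 fun h => hj (Finset.mem_filter.2 ⟨Finset.mem_univ _, h⟩))
  have hψO : ∀ i ∈ W, ψ i ∈ T ∪ H := fun i hi => by
    rcases hψ i hi with h1 | h1
    · exact Finset.mem_union_right _ (h1 ▸ (hkey i hi).1)
    · exact Finset.mem_union_left _ h1.1
  have hdist : ∀ i ∈ W, ∀ j, δ (Sum.inl (ψ i)) (Sum.inr j) * f i j ≤ 9 * R j * f i j :=
    fun i hi j => by
      by_cases hij : j ∈ J ∧ i ∈ L j
      · refine mul_le_mul_of_nonneg_right ?_ (hf0 i j)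
        have h1 := (hkey i hi).2.2.1
        have h2 := (hkey i hi).2.2.2 j hij.1 hij.2
        have h3 := (hLR hij.2).1
        have h4 := hδtri (Sum.inl (h i)) (Sum.inl i) (Sum.inr j)
        rw [hδsymm (Sum.inl (h i)) (Sum.inl i)] at h4
        rcases hψ i hi with h5 | ⟨h5, h6, h7⟩
        · rw [h5]
          linarith [hδnn (Sum.inl i) (Sum.inl (h i))]
        · have h8 := (hkey (ψ i) (hTW h5)).2.2.1
          have h9 := hδtri (Sum.inl (ψ i)) (Sum.inl (h i)) (Sum.inr j)
          rw [h6] at h8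
          linarith
      · simp only [hf, hij, if_false, mul_zero, le_refl]
  refine ⟨T ∪ H, Finset.union_subset (hTW.trans (Finset.filter_subset _ _)) hHS,
    fun t j => ∑ i ∈ W with ψ i = t, f i j, fun t j => Finset.sum_nonneg fun i _ => hf0 i j,
    fun t ht j => Finset.sum_eq_zero fun i hi => ?_, fun j => ?_, fun t => ?_, ?_, ?_⟩
  · rw [Finset.mem_filter] at hi
    exact absurd (hi.2 ▸ hψO i hi.1) ht
  · exact (Finset.sum_fiberwise _ _ _).trans (hfsum j)
  · rw [Finset.sum_comm]
    calc ∑ i ∈ W with ψ i = t, ∑ j, f i j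
        ≤ ∑ i ∈ W with ψ i = t, 3 / 2 * (y i * U i) := Finset.sum_le_sum fun i _ => by
          refine (Finset.sum_le_sum fun j _ => hfx i j).trans ?_
          rw [← Finset.mul_sum]
          linarith [hcap i]
      _ = 3 / 2 * ∑ i ∈ W with ψ i = t, y i * U i := (Finset.mul_sum _ _ _).symm
      _ ≤ U t := by linarith [hload t]
  · rw [Finset.sum_comm, Finset.sum_comm (s := S), Finset.mul_sum]
    refine Finset.sum_le_sum fun j _ => ?_
    calc ∑ t, δ (Sum.inl t) (Sum.inr j) * ∑ i ∈ W with ψ i = t, f i j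
        = ∑ t, ∑ i ∈ W with ψ i = t, δ (Sum.inl (ψ i)) (Sum.inr j) * f i j :=
          Finset.sum_congr rfl fun t _ => by
            rw [Finset.mul_sum]
            exact Finset.sum_congr rfl fun i hi => by rw [(Finset.mem_filter.1 hi).2]
      _ = ∑ i ∈ W, δ (Sum.inl (ψ i)) (Sum.inr j) * f i j := Finset.sum_fiberwise _ _ _
      _ ≤ ∑ i ∈ W, 9 * R j * f i j := Finset.sum_le_sum fun i hi => hdist i hi j
      _ = 9 * (R j * d j) := by rw [← Finset.mul_sum, hfsum, mul_assoc]
      _ ≤ 36 * ∑ i ∈ S, δ (Sum.inl i) (Sum.inr j) * x i j := by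
          rcases (hdnn j).eq_or_lt with h0 | h0
          · rw [← h0, mul_zero, mul_zero]
            exact mul_nonneg (by norm_num)
              (Finset.sum_nonneg fun i _ => mul_nonneg (hδnn _ _) (hx i j))
          · rw [(hRu j h0).1]
            linarith
  · have h1 : ∑ i ∈ T ∪ H, o i ≤ ∑ i ∈ T, o i + ∑ i ∈ H, o i := by
      rw [← Finset.sum_union_inter]
      exact le_add_of_nonneg_right (Finset.sum_nonneg fun i _ => ho i)
    have h2 : ∑ i ∈ W, o i * y i ≤ ∑ i ∈ S, o i * y i :=
      Finset.sum_le_sum_of_subset_of_nonneg (Finset.filter_subset _ _)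
        fun i _ _ => mul_nonneg (ho i) (hy0 i)
    linarith

theorem exists_injective_assignment {ν κ : Type*} [Fintype ν] [Fintype κ] (M c : ν → κ → ℝ)
    (hM : ∀ r j, 0 ≤ M r j) (hcol : ∀ j, ∑ r, M r j = 1) (hrow : ∀ r, ∑ j, M r j ≤ 1) :
    ∃ f : κ → ν, Function.Injective f ∧ ∑ j, c (f j) j ≤ ∑ r, ∑ j, c r j * M r j := by
  have htot : ∑ r, ∑ j, M r j = Fintype.card κ := by
    rw [Finset.sum_comm, Finset.sum_congr rfl fun j _ => hcol j]
    simp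
  have hcard : Fintype.card κ ≤ Fintype.card ν := by
    have : ∑ r, ∑ j, M r j ≤ ∑ _r : ν, (1 : ℝ) := Finset.sum_le_sum fun r _ => hrow r
    rw [htot] at this
    simpa using this
  set m := Fintype.card ν - Fintype.card κ with hm
  have hmR : (m : ℝ) = Fintype.card ν - Fintype.card κ := by
    rw [hm, Nat.cast_sub hcard]
  have hdef : ∑ r, (1 - ∑ j, M r j) = m := by
    rw [Finset.sum_sub_distrib, htot, hmR]
    simp
  have e : ν ≃ κ ⊕ Fin m := Fintype.equivOfCardEq (by simp [hm, hcard])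
  set A : Matrix ν ν ℝ := fun r s =>
    Sum.elim (M r) (fun _ => (1 - ∑ j, M r j) / m) (e s) with hA
  have hAds : A ∈ doublyStochastic ℝ ν := by
    rw [mem_doublyStochastic_iff_sum]
    refine ⟨fun r s => ?_, fun r => ?_, fun s => ?_⟩
    · simp only [hA]
      rcases e s with j | k
      · exact hM r j
      · exact div_nonneg (sub_nonneg.2 (hrow r)) (Nat.cast_nonneg _)
    · simp only [hA]
      rw [e.sum_comp (Sum.elim (M r) fun _ => (1 - ∑ j, M r j) / m), Fintype.sum_sum_type]
      simp only [Sum.elim_inl, Sum.elim_inr, Finset.sum_const, Finset.card_univ,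
        Fintype.card_fin, nsmul_eq_mul]
      rcases Nat.eq_zero_or_pos m with h | h
      · have := (Finset.sum_eq_zero_iff_of_nonneg
          fun r _ => sub_nonneg.2 (hrow r)).1 (by rw [hdef, h, Nat.cast_zero]) r
            (Finset.mem_univ r)
        rw [this, h]
        simp only [Nat.cast_zero, zero_mul, add_zero]
        linarith
      · have : (m : ℝ) ≠ 0 := by positivity
        field_simp
        ring
    · simp only [hA]
      rcases e s with j | k
      · exact hcol j
      · have : (m : ℝ) ≠ 0 := by
          have := k.pos
          positivity
        simp only [Sum.elim_inr]
        rw [← Finset.sum_div, hdef, div_self this]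
  obtain ⟨w, hw0, hw1, hwA⟩ := exists_eq_sum_perm_of_mem_doublyStochastic hAds
  set C : ν → ν → ℝ := fun r s => Sum.elim (c r) (fun _ => 0) (e s) with hC
  have hCA : ∑ r, ∑ s, C r s * A r s = ∑ r, ∑ j, c r j * M r j := by
    refine Finset.sum_congr rfl fun r _ => ?_
    simp only [hC, hA]
    rw [e.sum_comp fun s => Sum.elim (c r) (fun _ => 0) s *
      Sum.elim (M r) (fun _ => (1 - ∑ j, M r j) / m) s, Fintype.sum_sum_type]
    simp
  have hCw : ∑ r, ∑ s, C r s * A r s = ∑ σ, w σ * ∑ r, C r (σ r) := by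
    rw [← hwA]
    simp only [Matrix.sum_apply, Matrix.smul_apply, smul_eq_mul, Finset.mul_sum,
      Equiv.Perm.permMatrix, PEquiv.toMatrix_apply, Equiv.toPEquiv_apply, Option.mem_def,
      Option.some.injEq]
    rw [Finset.sum_congr rfl fun r _ => Finset.sum_comm, Finset.sum_comm]
    refine Finset.sum_congr rfl fun σ _ => Finset.sum_congr rfl fun r _ => ?_
    simp [mul_comm]
  obtain ⟨σ, hσ⟩ : ∃ σ : Equiv.Perm ν, ∑ r, C r (σ r) ≤ ∑ r, ∑ j, c r j * M r j := by
    by_contra! h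
    rw [← hCA, hCw] at h
    set B := ∑ σ, w σ * ∑ r, C r (σ r) with hB
    have h1 : ∑ σ, w σ * B = B := by rw [← Finset.sum_mul, hw1, one_mul]
    obtain ⟨σ, hσ⟩ : ∃ σ, 0 < w σ := by
      by_contra! h0
      have : ∑ σ, w σ ≤ 0 := Finset.sum_nonpos fun σ _ => h0 σ
      linarith
    have h2 : ∑ σ, w σ * B < ∑ σ, w σ * ∑ r, C r (σ r) :=
      Finset.sum_lt_sum (fun τ _ => mul_le_mul_of_nonneg_left (h τ).le (hw0 τ))
        ⟨σ, Finset.mem_univ _, mul_lt_mul_of_pos_left (h σ) hσ⟩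
    linarith
  refine ⟨fun j => σ.symm (e.symm (Sum.inl j)), fun j j' h => ?_, ?_⟩
  · simpa using h
  · have h1 : ∑ r, C r (σ r) = ∑ s, C (σ.symm s) s := by
      rw [← Equiv.sum_comp σ fun s => C (σ.symm s) s]
      simp
    have h2 : ∑ s, C (σ.symm s) s = ∑ j, c (σ.symm (e.symm (Sum.inl j))) j := by
      rw [← e.symm.sum_comp, Fintype.sum_sum_type]
      simp [hC]
    rw [← h2, ← h1]
    exact hσ

theorem exists_integral_assignment {ι κ : Type*} [Fintype ι] [Fintype κ] (V : ι → ℕ)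
    (X c : ι → κ → ℝ) (hX : ∀ i j, 0 ≤ X i j) (hsum : ∀ j, ∑ i, X i j = 1)
    (hcap : ∀ i, ∑ j, X i j ≤ V i) :
    ∃ φ : κ → ι, (∀ i, (Finset.univ.filter fun j => φ j = i).card ≤ V i) ∧
      ∑ j, c (φ j) j ≤ ∑ i, ∑ j, c i j * X i j := by
  have hV : ∀ i j, (V i : ℝ) * (X i j / V i) = X i j := fun i j => by
    rcases Nat.eq_zero_or_pos (V i) with h | h
    · have h0 := hcap i
      rw [h, Nat.cast_zero] at h0
      have := Finset.single_le_sum (f := fun j => X i j) (fun j _ => hX i j) (Finset.mem_univ j)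
      rw [h, le_antisymm (this.trans h0) (hX i j)]
      simp
    · field_simp
  have hslot : ∀ g : ι → ℝ, ∑ r : (Σ i, Fin (V i)), g r.1 = ∑ i, V i * g i := fun g => by
    rw [Fintype.sum_sigma]
    simp
  obtain ⟨f, hf, hcost⟩ := exists_injective_assignment
    (fun (r : Σ i, Fin (V i)) j => X r.1 j / V r.1) (fun r j => c r.1 j)
    (fun r j => div_nonneg (hX _ _) (Nat.cast_nonneg _))
    (fun j => by rw [hslot fun i => X i j / V i, ← hsum j]; simp only [hV])
    (fun r => by
      rw [← Finset.sum_div]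
      exact div_le_one_of_le₀ (hcap _) (Nat.cast_nonneg _))
  refine ⟨fun j => (f j).1, fun i => ?_, hcost.trans_eq ?_⟩
  · calc (Finset.univ.filter fun j => (f j).1 = i).card
        = ((Finset.univ.filter fun j => (f j).1 = i).image f).card :=
          (Finset.card_image_of_injective _ hf).symm
      _ ≤ (Finset.univ.image fun k : Fin (V i) => (⟨i, k⟩ : Σ i, Fin (V i))).card := by
          refine Finset.card_le_card fun r hr => ?_
          obtain ⟨j, hj, rfl⟩ := Finset.mem_image.1 hr
          obtain rfl := (Finset.mem_filter.1 hj).2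
          exact Finset.mem_image.2 ⟨(f j).2, Finset.mem_univ _, rfl⟩
      _ ≤ V i := Finset.card_image_le.trans_eq (by simp)
  · rw [hslot fun i => ∑ j, c i j * (X i j / V i)]
    refine Finset.sum_congr rfl fun i _ => ?_
    rw [Finset.mul_sum]
    refine Finset.sum_congr rfl fun j _ => ?_
    rw [mul_left_comm, hV]

/-- Every semi-integral pair admits an integral solution of cost at
most `36` times larger. -/
theorem stmt_15 (U : F → ℕ) (hU : ∀ i, 0 < U i)
    (o : F → ℝ) (ho : ∀ i, 0 ≤ o i)
    (dmet : F ⊕ D → F ⊕ D → ℝ)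
    (hd0 : ∀ u, dmet u u = 0)
    (hdsym : ∀ u v, dmet u v = dmet v u)
    (hdtri : ∀ u v w, dmet u w ≤ dmet u v + dmet v w)
    (xhat : F → D → ℝ) (yhat : F → ℝ)
    (hsemi : SemiIntegral U xhat yhat) :
    ∃ (xb : F → D → ℝ) (yb : F → ℝ),
      IsIntegralSolution U xb yb ∧
        cflCost o (fun i j => dmet (Sum.inl i) (Sum.inr j)) xb yb ≤
          36 * cflCost o (fun i j => dmet (Sum.inl i) (Sum.inr j)) xhat yhat := by
  obtain ⟨hx, hy, hsum, hcap, hhalf, hxy⟩ := hsemi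
  have hδnn : ∀ a b, 0 ≤ dmet a b := fun a b => by
    have := hdtri a b a
    rw [hd0, hdsym b a] at this
    linarith
  set S : Finset F := Finset.univ.filter fun i => yhat i ≠ 1 with hS
  have hmem : ∀ {i}, i ∈ S ↔ yhat i ≠ 1 := by simp [hS]
  have hsplit : ∀ g : F → ℝ, ∑ i, g i = ∑ i, (if yhat i = 1 then g i else 0) + ∑ i ∈ S, g i :=
    fun g => by
      rw [← Finset.sum_filter, hS]
      exact (Finset.sum_filter_add_sum_filter_not _ _ _).symm
  obtain ⟨O, hOS, X, hX0, hXO, hXsum, hXcap, hXcost, hOcost⟩ :=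
    exists_consolidated_assignment U hU o ho dmet hd0 hdsym hdtri S xhat yhat
      (fun i j => (hx i j).1) (fun i => (hy i).1)
      (fun i hi => (hhalf i).resolve_left (hmem.1 hi)) hcap
      (fun i hi j => hxy i (hmem.1 hi) j)
  have hopen : ∀ i, yhat i = 1 → i ∉ O := fun i hi hiO => hmem.1 (hOS hiO) hi
  obtain ⟨φ, hφcap, hφcost⟩ := exists_integral_assignment
    (fun i => if yhat i = 1 ∨ i ∈ O then U i else 0)
    (fun i j => (if yhat i = 1 then xhat i j else 0) + X i j)
    (fun i j => dmet (Sum.inl i) (Sum.inr j))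
    (fun i j => add_nonneg (by split_ifs; exacts [(hx i j).1, le_rfl]) (hX0 i j))
    (fun j => by rw [Finset.sum_add_distrib, hXsum, ← hsplit fun i => xhat i j, hsum])
    (fun i => by
      by_cases hi : yhat i = 1
      · simp only [hi, if_true, true_or, hXO i (hopen i hi), add_zero]
        simpa [hi] using hcap i
      · by_cases hiO : i ∈ O
        · simpa [hi, hiO] using hXcap i
        · simp [hi, hiO, hXO i hiO])
  have hφopen : ∀ j, yhat (φ j) = 1 ∨ φ j ∈ O := fun j => by
    by_contra hj
    have h1 := hφcap (φ j)
    rw [if_neg hj, Nat.le_zero, Finset.card_eq_zero] at h1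
    exact Finset.notMem_empty j (h1 ▸ Finset.mem_filter.2 ⟨Finset.mem_univ _, rfl⟩)
  refine ⟨fun i j => if φ j = i then 1 else 0, fun i => if yhat i = 1 ∨ i ∈ O then 1 else 0,
    ⟨fun i j => (ite_eq_or_eq _ _ _).symm, fun i => (ite_eq_or_eq _ _ _).symm, fun i j => ?_,
      fun j => by simp, fun i => ?_⟩, ?_⟩
  · dsimp only
    by_cases hij : φ j = i
    · rw [if_pos hij, if_pos (hij ▸ hφopen j)]
    · rw [if_neg hij]
      split_ifs <;> norm_num
  · have h1 : ((Finset.univ.filter fun j => φ j = i).card : ℝ) ≤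
        ((if yhat i = 1 ∨ i ∈ O then U i else 0 : ℕ) : ℝ) := by exact_mod_cast hφcap i
    rw [Finset.sum_boole]
    refine h1.trans_eq ?_
    by_cases hi : yhat i = 1 ∨ i ∈ O <;> simp only [hi, if_true, if_false] <;> simp
  · have hconn : ∑ i, ∑ j, dmet (Sum.inl i) (Sum.inr j) * (if φ j = i then (1 : ℝ) else 0) ≤
        36 * ∑ i, ∑ j, dmet (Sum.inl i) (Sum.inr j) * xhat i j := by
      have h1 : ∑ i, ∑ j, dmet (Sum.inl i) (Sum.inr j) * (if φ j = i then (1 : ℝ) else 0) =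
          ∑ j, dmet (Sum.inl (φ j)) (Sum.inr j) := by
        rw [Finset.sum_comm]
        simp
      have h2 : ∑ i, ∑ j, dmet (Sum.inl i) (Sum.inr j) *
          ((if yhat i = 1 then xhat i j else 0) + X i j) =
          ∑ i, (if yhat i = 1 then ∑ j, dmet (Sum.inl i) (Sum.inr j) * xhat i j else 0) +
            ∑ i, ∑ j, dmet (Sum.inl i) (Sum.inr j) * X i j := by
        rw [← Finset.sum_add_distrib]
        refine Finset.sum_congr rfl fun i _ => ?_
        split_ifs <;> simp [mul_add, Finset.sum_add_distrib]
      have h3 : 0 ≤ ∑ i, (if yhat i = 1 then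
          ∑ j, dmet (Sum.inl i) (Sum.inr j) * xhat i j else 0) :=
        Finset.sum_nonneg fun i _ => by
          split_ifs
          · exact Finset.sum_nonneg fun j _ => mul_nonneg (hδnn _ _) (hx i j).1
          · exact le_rfl
      rw [h1, hsplit fun i => ∑ j, dmet (Sum.inl i) (Sum.inr j) * xhat i j]
      rw [h2] at hφcost
      linarith
    have hopening : ∑ i, o i * (if yhat i = 1 ∨ i ∈ O then (1 : ℝ) else 0) ≤
        36 * ∑ i, o i * yhat i := by
      have h1 : ∑ i, o i * (if yhat i = 1 ∨ i ∈ O then (1 : ℝ) else 0) ≤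
          ∑ i, (if yhat i = 1 then o i * yhat i else 0) + ∑ i ∈ O, o i := by
        rw [← Finset.sum_filter_add_sum_filter_not Finset.univ (fun i => i ∈ O) fun i =>
            o i * (if yhat i = 1 ∨ i ∈ O then (1 : ℝ) else 0), add_comm]
        refine add_le_add ?_ ?_
        · rw [Finset.sum_filter]
          refine Finset.sum_le_sum fun i _ => ?_
          by_cases hi : yhat i = 1
          · simp [hi, hopen i hi]
          · by_cases hiO : i ∈ O <;> simp [hi, hiO]
        · rw [Finset.filter_mem_eq_inter, Finset.univ_inter]
          exact Finset.sum_le_sum fun i hi => by rw [if_pos (Or.inr hi), mul_one]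
      have h2 : 0 ≤ ∑ i, (if yhat i = 1 then o i * yhat i else 0) :=
        Finset.sum_nonneg fun i _ => by
          split_ifs
          · exact mul_nonneg (ho i) (hy i).1
          · exact le_rfl
      rw [hsplit fun i => o i * yhat i]
      linarith
    unfold cflCost
    linarith
end
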